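/- Let s > 1/2, let R ∈ ℝ^{d×d} be symmetric and positive semidefinite, and set g(x) = e^{−⟨Rx,x⟩}. For a tempered distribution u ∈ 𝒮'(ℝ^d), let g·u ∈ 𝒮'(ℝ^d) be the tempered distribution defined by (g·u)(φ) = u(g·φ) (note g·φ is Schwartz for φ Schwartz, since g is smooth and bounded with all derivatives polynomially bounded). Then WF^s(g·u) ⊆ WF^s(u). -/

import Mathlib

open MeasureTheory Filter
open scoped BigOperators ENNReal RealInnerProductSpace

noncomputable section

/-- `ℝ^d` with the Euclidean norm. -/
abbrev Ed (d : ℕ) : Type := EuclideanSpace ℝ (Fin d)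

/-- Partial derivative along the `i`-th coordinate direction. -/
def pdGS {d : ℕ} (i : Fin d) (f : Ed d → ℂ) : Ed d → ℂ :=
  fun x => fderiv ℝ f x (EuclideanSpace.single i 1)

/-- Multi-index partial derivative `∂^β`. -/
def mderiv {d : ℕ} (β : Fin d → ℕ) (f : Ed d → ℂ) : Ed d → ℂ :=
  ((List.ofFn fun i : Fin d => (pdGS i)^[β i]).foldr (· ∘ ·) id) f

/-- Monomial `x^α`. -/
def mpow {d : ℕ} (x : Ed d) (α : Fin d → ℕ) : ℝ := ∏ i, x i ^ α i

/-- Multi-index factorial `α!`. -/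
def mfact {d : ℕ} (α : Fin d → ℕ) : ℕ := ∏ i, Nat.factorial (α i)

/-- Multi-index length `|α|`. -/
def mlen {d : ℕ} (α : Fin d → ℕ) : ℕ := ∑ i, α i

/-- The Gelfand–Shilov seminorm `‖f‖_{S_{s,h}}`, valued in `[0,∞]`. -/
def GSnorm {d : ℕ} (s h : ℝ) (f : Ed d → ℂ) : ℝ≥0∞ :=
  ⨆ (x : Ed d) (α : Fin d → ℕ) (β : Fin d → ℕ),
    ENNReal.ofReal (|mpow x α| * ‖mderiv β f x‖ /
      (h ^ (mlen α + mlen β) * ((mfact α : ℝ) * (mfact β : ℝ)) ^ s))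

/-- The Gelfand–Shilov space `Σ_s(ℝ^d)`: smooth functions all of whose
`S_{s,h}` seminorms are finite. -/
def SigmaGS (s : ℝ) (d : ℕ) : Set (Ed d → ℂ) :=
  {f | ContDiff ℝ ((⊤ : ℕ∞) : WithTop ℕ∞) f ∧ ∀ h : ℝ, 0 < h → GSnorm s h f < ⊤}

/-- The seminorm `|f|_A`, valued in `[0,∞]`. -/
def GSnormA {d : ℕ} (s A : ℝ) (f : Ed d → ℂ) : ℝ≥0∞ :=
  ⨆ (x : Ed d) (β : Fin d → ℕ),
    ENNReal.ofReal (A ^ mlen β * Real.exp (A * ‖x‖ ^ (1/s)) * ‖mderiv β f x‖ /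
      (mfact β : ℝ) ^ s)

/-- The Fourier transform `f̂(ξ) = ∫ f(x) e^{-i⟨x,ξ⟩} dx`. -/
def FTgs {d : ℕ} (f : Ed d → ℂ) (ξ : Ed d) : ℂ :=
  ∫ x : Ed d, f x * Complex.exp (-(Complex.I * (⟪x, ξ⟫ : ℝ)))

/-- The short-time Fourier transform of a function `f` with window `φ`. -/
def STFTgs {d : ℕ} (φ f : Ed d → ℂ) (z : Ed d × Ed d) : ℂ :=
  ∫ y : Ed d, f y * (starRingEnd ℂ) (φ (y - z.1)) * Complex.exp (-(Complex.I * (⟪y, z.2⟫ : ℝ)))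

/-- Euclidean norm of a phase-space point `(x,ξ) ∈ ℝ^{2d}`. -/
def pnorm {d : ℕ} (z : Ed d × Ed d) : ℝ := Real.sqrt (‖z.1‖ ^ 2 + ‖z.2‖ ^ 2)

/-- A conic subset: invariant under multiplication by positive reals. -/
def IsConic {V : Type*} [SMul ℝ V] (Γ : Set V) : Prop :=
  ∀ t : ℝ, 0 < t → ∀ z ∈ Γ, t • z ∈ Γ

/-- Tempered distributions on `ℝ^d`. -/
abbrev TD (d : ℕ) : Type := SchwartzMap (Ed d) ℂ →L[ℂ] ℂ

/-- `W` is the short-time Fourier transform `V_φ u` of the tempered distribution `u`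
with respect to the window `φ`. -/
def IsSTFT {d : ℕ} (u : TD d) (φ : Ed d → ℂ) (W : Ed d × Ed d → ℂ) : Prop :=
  ∀ (x ξ : Ed d) (g : SchwartzMap (Ed d) ℂ),
    (∀ y : Ed d, g y = (starRingEnd ℂ) (φ (y - x)) * Complex.exp (-(Complex.I * (⟪y, ξ⟫ : ℝ)))) →
    W (x, ξ) = u g

/-- The `s`-Gelfand–Shilov wave front set of a distribution whose short-time Fourier
transform is `W`: the set of nonzero phase-space points having no open conic
neighbourhood on which `e^{A|z|^{1/s}} |W(z)|` is bounded for every `A > 0`. -/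
def WFs {d : ℕ} (s : ℝ) (W : Ed d × Ed d → ℂ) : Set (Ed d × Ed d) :=
  {z₀ | z₀ ≠ 0 ∧ ¬ ∃ Γ : Set (Ed d × Ed d), IsOpen Γ ∧ IsConic Γ ∧
    (0 : Ed d × Ed d) ∉ Γ ∧ z₀ ∈ Γ ∧
    ∀ A : ℝ, 0 < A → ∃ C : ℝ, ∀ z ∈ Γ, Real.exp (A * pnorm z ^ (1/s)) * ‖W z‖ ≤ C}

/-- The real quadratic form `⟨Bx, x⟩` of a matrix `B`. -/
def qf {d : ℕ} (B : Matrix (Fin d) (Fin d) ℝ) (x : Ed d) : ℝ :=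
  ∑ i, (∑ j, B i j * x j) * x i

/-- Tempered distributions on `ℝ^m × ℝ^n`. -/
abbrev TD2 (m n : ℕ) : Type := SchwartzMap (Ed m × Ed n) ℂ →L[ℂ] ℂ

/-- Short-time Fourier transform of a tempered distribution on `ℝ^m × ℝ^n`. -/
def IsSTFT2 {m n : ℕ} (w : TD2 m n) (Φ : Ed m × Ed n → ℂ)
    (W : (Ed m × Ed n) × (Ed m × Ed n) → ℂ) : Prop :=
  ∀ (x ξ : Ed m × Ed n) (g : SchwartzMap (Ed m × Ed n) ℂ),
    (∀ y : Ed m × Ed n, g y = (starRingEnd ℂ) (Φ (y - x)) *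
      Complex.exp (-(Complex.I * ((⟪y.1, ξ.1⟫ + ⟪y.2, ξ.2⟫ : ℝ))))) →
    W (x, ξ) = w g

/-- Euclidean norm of a phase-space point of `T^*(ℝ^m × ℝ^n)`. -/
def pnorm2 {m n : ℕ} (z : (Ed m × Ed n) × (Ed m × Ed n)) : ℝ :=
  Real.sqrt (‖z.1.1‖ ^ 2 + ‖z.1.2‖ ^ 2 + ‖z.2.1‖ ^ 2 + ‖z.2.2‖ ^ 2)

/-- The `s`-Gelfand–Shilov wave front set on `ℝ^m × ℝ^n`. -/
def WFs2 {m n : ℕ} (s : ℝ) (W : (Ed m × Ed n) × (Ed m × Ed n) → ℂ) :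
    Set ((Ed m × Ed n) × (Ed m × Ed n)) :=
  {z₀ | z₀ ≠ 0 ∧ ¬ ∃ Γ : Set ((Ed m × Ed n) × (Ed m × Ed n)), IsOpen Γ ∧ IsConic Γ ∧
    (0 : (Ed m × Ed n) × (Ed m × Ed n)) ∉ Γ ∧ z₀ ∈ Γ ∧
    ∀ A : ℝ, 0 < A → ∃ C : ℝ, ∀ z ∈ Γ, Real.exp (A * pnorm2 z ^ (1/s)) * ‖W z‖ ≤ C}

open SchwartzMap Topology in
/-- The weighted derivative `‖y‖^k D^l f(y)` of a Schwartz function as a bounded continuous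
function. -/
def weightedDeriv {E : Type*} [NormedAddCommGroup E] [NormedSpace ℝ E] (k l : ℕ)
    (f : 𝓢(E, ℂ)) : BoundedContinuousFunction E (E [×l]→L[ℝ] ℂ) :=
  BoundedContinuousFunction.ofNormedAddCommGroup (fun y => ‖y‖ ^ k • iteratedFDeriv ℝ l f y)
    ((continuous_norm.pow k).smul ((f.smooth ⊤).continuous_iteratedFDeriv (mod_cast le_top)))
    (SchwartzMap.seminorm ℂ k l f)
    (fun y => by
      rw [norm_smul, norm_pow, norm_norm]
      exact SchwartzMap.le_seminorm ℂ k l f y)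

open SchwartzMap in
@[simp]
theorem weightedDeriv_apply {E : Type*} [NormedAddCommGroup E] [NormedSpace ℝ E] (k l : ℕ)
    (f : 𝓢(E, ℂ)) (y : E) : weightedDeriv k l f y = ‖y‖ ^ k • iteratedFDeriv ℝ l f y := rfl

open SchwartzMap in
theorem norm_weightedDeriv_le {E : Type*} [NormedAddCommGroup E] [NormedSpace ℝ E] (k l : ℕ)
    (f : 𝓢(E, ℂ)) : ‖weightedDeriv k l f‖ ≤ SchwartzMap.seminorm ℂ k l f :=
  BoundedContinuousFunction.norm_ofNormedAddCommGroup_le _ (apply_nonneg _ _) _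

open SchwartzMap in
theorem seminorm_le_norm_weightedDeriv {E : Type*} [NormedAddCommGroup E] [NormedSpace ℝ E]
    (k l : ℕ) (f : 𝓢(E, ℂ)) : SchwartzMap.seminorm ℂ k l f ≤ ‖weightedDeriv k l f‖ := by
  refine SchwartzMap.seminorm_le_bound ℂ k l f (norm_nonneg (weightedDeriv k l f)) fun y => ?_
  have := (weightedDeriv k l f).norm_coe_le_norm y
  rwa [weightedDeriv_apply, norm_smul, norm_pow, norm_norm] at this

/-- The Banach space in which finitely many weighted derivatives live. -/
def WeightedDerivSpace (E : Type*) [NormedAddCommGroup E] [NormedSpace ℝ E]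
    (S : Finset (ℕ × ℕ)) : Type _ :=
  (i : S) → BoundedContinuousFunction E (E [×i.1.2]→L[ℝ] ℂ)

instance (E : Type*) [NormedAddCommGroup E] [NormedSpace ℝ E] (S : Finset (ℕ × ℕ)) :
    NormedAddCommGroup (WeightedDerivSpace E S) :=
  inferInstanceAs (NormedAddCommGroup
    ((i : S) → BoundedContinuousFunction E (E [×i.1.2]→L[ℝ] ℂ)))

instance (E : Type*) [NormedAddCommGroup E] [NormedSpace ℝ E] (S : Finset (ℕ × ℕ)) :
    NormedSpace ℂ (WeightedDerivSpace E S) :=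
  inferInstanceAs (NormedSpace ℂ
    ((i : S) → BoundedContinuousFunction E (E [×i.1.2]→L[ℝ] ℂ)))

instance (E : Type*) [NormedAddCommGroup E] [NormedSpace ℝ E] (S : Finset (ℕ × ℕ)) :
    CompleteSpace (WeightedDerivSpace E S) :=
  inferInstanceAs (CompleteSpace
    ((i : S) → BoundedContinuousFunction E (E [×i.1.2]→L[ℝ] ℂ)))

/-- Evaluation of one of the weighted derivatives at a point. -/
def weightedDerivEval {E : Type*} [NormedAddCommGroup E] [NormedSpace ℝ E]
    (S : Finset (ℕ × ℕ)) (i : S) (y : E) :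
    WeightedDerivSpace E S →L[ℂ] (E [×i.1.2]→L[ℝ] ℂ) :=
  LinearMap.mkContinuous
    { toFun := fun e => e i y
      map_add' := fun _ _ => rfl
      map_smul' := fun _ _ => rfl } 1 fun e => by
    rw [one_mul]
    exact ((e i).norm_coe_le_norm y).trans (norm_le_pi_norm
      (e : (i : S) → BoundedContinuousFunction E (E [×i.1.2]→L[ℝ] ℂ)) i)

theorem weightedDerivSpace_ext {E : Type*} [NormedAddCommGroup E] [NormedSpace ℝ E]
    {S : Finset (ℕ × ℕ)} {e e' : WeightedDerivSpace E S}
    (h : ∀ i y, weightedDerivEval S i y e = weightedDerivEval S i y e') : e = e' :=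
  funext fun i => BoundedContinuousFunction.ext fun y => h i y

open SchwartzMap in
/-- Finitely many weighted derivatives, as a linear map to a Banach space. -/
def weightedDerivs {E : Type*} [NormedAddCommGroup E] [NormedSpace ℝ E] (S : Finset (ℕ × ℕ)) :
    𝓢(E, ℂ) →ₗ[ℂ] WeightedDerivSpace E S where
  toFun f := fun i => weightedDeriv i.1.1 i.1.2 f
  map_add' f g := by
    refine weightedDerivSpace_ext fun i y => ?_
    have h : ((f + g : 𝓢(E, ℂ)) : E → ℂ) = (f : E → ℂ) + (g : E → ℂ) := by ext; simp
    change ‖y‖ ^ i.1.1 • iteratedFDeriv ℝ i.1.2 ((f + g : 𝓢(E, ℂ)) : E → ℂ) y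
      = ‖y‖ ^ i.1.1 • iteratedFDeriv ℝ i.1.2 f y + ‖y‖ ^ i.1.1 • iteratedFDeriv ℝ i.1.2 g y
    rw [h]
    rw [iteratedFDeriv_add_apply ((f.smooth i.1.2).contDiffAt)
      ((g.smooth i.1.2).contDiffAt), smul_add]
  map_smul' c f := by
    refine weightedDerivSpace_ext fun i y => ?_
    have h : ((c • f : 𝓢(E, ℂ)) : E → ℂ) = c • (f : E → ℂ) := by ext; simp
    change ‖y‖ ^ i.1.1 • iteratedFDeriv ℝ i.1.2 ((c • f : 𝓢(E, ℂ)) : E → ℂ) y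
      = c • (‖y‖ ^ i.1.1 • iteratedFDeriv ℝ i.1.2 f y)
    rw [h]
    rw [iteratedFDeriv_const_smul_apply ((f.smooth i.1.2).contDiffAt), smul_comm]

open SchwartzMap in
theorem iteratedFDeriv_eq_integral {E Z : Type*} [NormedAddCommGroup E] [NormedSpace ℝ E]
    [TopologicalSpace Z] [MeasurableSpace Z] [OpensMeasurableSpace Z]
    [SecondCountableTopology Z] (μ : Measure Z) (F : Z → 𝓢(E, ℂ))
    (hF : Continuous F) (hint : ∀ k l, Integrable (fun z => SchwartzMap.seminorm ℂ k l (F z)) μ)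
    (f : 𝓢(E, ℂ)) (hf : ∀ y, f y = ∫ z, F z y ∂μ) (l : ℕ) (y : E) :
    iteratedFDeriv ℝ l f y = ∫ z, iteratedFDeriv ℝ l (F z) y ∂μ := by
  have hcont : ∀ (l : ℕ) (y : E), Continuous fun z => iteratedFDeriv ℝ l (F z) y := by
    intro l y
    refine continuous_iff_continuousAt.2 fun z₀ => ?_
    have h0 := ((schwartz_withSeminorms ℂ E ℂ).tendsto_nhds F (F z₀)).1 (hF.tendsto z₀)
    rw [ContinuousAt, Metric.tendsto_nhds]
    intro ε hε
    filter_upwards [h0 (0, l) ε hε] with z hz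
    refine lt_of_le_of_lt ?_ hz
    rw [dist_eq_norm]
    have := SchwartzMap.norm_iteratedFDeriv_le_seminorm ℂ (F z - F z₀) l y
    have h : ((F z - F z₀ : 𝓢(E, ℂ)) : E → ℂ) = (F z : E → ℂ) - (F z₀ : E → ℂ) := by ext; simp
    rw [h, iteratedFDeriv_sub_apply ((F z).smooth l).contDiffAt ((F z₀).smooth l).contDiffAt]
      at this
    exact this
  have hI : ∀ (l : ℕ) (y : E), Integrable (fun z => iteratedFDeriv ℝ l (F z) y) μ := fun l y =>
    (hint 0 l).mono' (hcont l y).aestronglyMeasurable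
      (Eventually.of_forall fun z => SchwartzMap.norm_iteratedFDeriv_le_seminorm ℂ (F z) l y)
  have hder : ∀ (g : 𝓢(E, ℂ)) (l : ℕ) (y : E) (m : Fin (l + 1) → E) (t : ℝ),
      HasDerivAt (fun t : ℝ => iteratedFDeriv ℝ l g (y + t • m 0) (Fin.tail m))
        (iteratedFDeriv ℝ (l + 1) g (y + t • m 0) m) t := by
    intro g l y m t
    have h1 : HasFDerivAt (iteratedFDeriv ℝ l g) (fderiv ℝ (iteratedFDeriv ℝ l g) (y + t • m 0))
        (y + t • m 0) := ((g.smooth ⊤).differentiable_iteratedFDeriv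
          (mod_cast ENat.natCast_lt_top l) _).hasFDerivAt
    have h2 : HasDerivAt (fun t : ℝ => y + t • m 0) (m 0) t := by
      simpa using ((hasDerivAt_id t).smul_const (m 0)).const_add y
    have h3 := h1.comp_hasDerivAt t h2
    have h4 := ((ContinuousMultilinearMap.apply ℝ (fun _ : Fin l => E) ℂ
      (Fin.tail m)).hasFDerivAt).comp_hasDerivAt t h3
    rw [iteratedFDeriv_succ_apply_left]
    exact h4
  have key : ∀ (m : Fin l → E),
      iteratedFDeriv ℝ l f y m = ∫ z, iteratedFDeriv ℝ l (F z) y m ∂μ := by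
    induction l generalizing y with
    | zero => intro m; simp [hf]
    | succ l ih =>
      intro m
      have hd := hasDerivAt_integral_of_dominated_loc_of_deriv_le (𝕜 := ℝ) (μ := μ)
        (F := fun (t : ℝ) z => iteratedFDeriv ℝ l (F z) (y + t • m 0) (Fin.tail m))
        (F' := fun (t : ℝ) z => iteratedFDeriv ℝ (l + 1) (F z) (y + t • m 0) m) (x₀ := 0)
        (bound := fun z => SchwartzMap.seminorm ℂ 0 (l + 1) (F z) * ∏ i, ‖m i‖) univ_mem
        (Eventually.of_forall fun t => ((ContinuousMultilinearMap.apply ℝ (fun _ : Fin l => E) ℂ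
          (Fin.tail m)).continuous.comp (hcont l _)).aestronglyMeasurable)
        ((ContinuousMultilinearMap.apply ℝ (fun _ : Fin l => E) ℂ
          (Fin.tail m)).integrable_comp (hI l _))
        (((ContinuousMultilinearMap.apply ℝ (fun _ : Fin (l + 1) => E) ℂ
          m).continuous.comp (hcont (l + 1) _)).aestronglyMeasurable)
        (Eventually.of_forall fun z t _ => by
          refine (ContinuousMultilinearMap.le_opNorm _ _).trans ?_
          gcongr
          exact SchwartzMap.norm_iteratedFDeriv_le_seminorm ℂ (F z) (l + 1) _)
        ((hint 0 (l + 1)).mul_const _)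
        (Eventually.of_forall fun z t _ => hder (F z) l y m t)
      have hd' := hder f l y m 0
      simp_rw [fun t : ℝ => ih (y + t • m 0) (Fin.tail m)] at hd'
      simpa using hd'.unique hd.2
  ext m
  exact (key m).trans (ContinuousMultilinearMap.integral_apply (hI l y) m).symm

open SchwartzMap in
/-- A continuous linear functional on the Schwartz space commutes with absolutely convergent
integrals of Schwartz functions. -/
theorem apply_eq_integral_of_pointwise {E Z : Type*} [NormedAddCommGroup E] [NormedSpace ℝ E]
    [TopologicalSpace Z] [MeasurableSpace Z] [OpensMeasurableSpace Z]
    [SecondCountableTopology Z] (μ : Measure Z)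
    (u : 𝓢(E, ℂ) →L[ℂ] ℂ) (F : Z → 𝓢(E, ℂ))
    (hF : Continuous F) (hint : ∀ k l, Integrable (fun z => SchwartzMap.seminorm ℂ k l (F z)) μ)
    (f : 𝓢(E, ℂ)) (hf : ∀ y, f y = ∫ z, F z y ∂μ) :
    u f = ∫ z, u (F z) ∂μ := by
  obtain ⟨S, C, -, hC⟩ := Seminorm.bound_of_continuous (schwartz_withSeminorms ℂ E ℂ)
    ((normSeminorm ℂ ℂ).comp u.toLinearMap) (by exact continuous_norm.comp u.continuous)
  set J := weightedDerivs (E := E) S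
  have hle : ∀ g : 𝓢(E, ℂ), ‖u g‖ ≤ C * ‖J g‖ := by
    intro g
    refine (hC g).trans ?_
    change (C : ℝ) * _ ≤ _
    gcongr
    refine Seminorm.finset_sup_apply_le (norm_nonneg _) fun i hi => ?_
    exact (seminorm_le_norm_weightedDeriv i.1 i.2 g).trans (norm_le_pi_norm
      (J g : (i : S) → BoundedContinuousFunction E (E [×i.1.2]→L[ℝ] ℂ)) ⟨i, hi⟩)
  have hJle : ∀ g : 𝓢(E, ℂ), ‖J g‖ ≤ ∑ i ∈ S, SchwartzMap.seminorm ℂ i.1 i.2 g := by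
    intro g
    refine (pi_norm_le_iff_of_nonneg
      (x := (J g : (i : S) → BoundedContinuousFunction E (E [×i.1.2]→L[ℝ] ℂ)))
      (Finset.sum_nonneg fun i _ => apply_nonneg _ _)).2 fun i => ?_
    exact (norm_weightedDeriv_le i.1.1 i.1.2 g).trans
      (Finset.single_le_sum (f := fun i : ℕ × ℕ => SchwartzMap.seminorm ℂ i.1 i.2 g)
        (fun i _ => apply_nonneg _ _) i.2)
  have hJF : Continuous fun z => J (F z) := by
    refine continuous_iff_continuousAt.2 fun z₀ => ?_
    have h0 := ((schwartz_withSeminorms ℂ E ℂ).tendsto_nhds F (F z₀)).1 (hF.tendsto z₀)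
    have h1 : Tendsto (fun z => ∑ i ∈ S, SchwartzMap.seminorm ℂ i.1 i.2 (F z - F z₀))
        (nhds z₀) (nhds 0) := by
      rw [show (0 : ℝ) = ∑ i ∈ S, 0 by simp]
      refine tendsto_finsetSum _ fun i _ => ?_
      rw [Metric.tendsto_nhds]
      intro ε hε
      filter_upwards [h0 i ε hε] with z hz
      rw [Real.dist_eq, sub_zero, abs_of_nonneg (apply_nonneg _ _)]
      exact hz
    rw [ContinuousAt, tendsto_iff_norm_sub_tendsto_zero]
    refine squeeze_zero (fun _ => norm_nonneg _) (fun z => ?_) h1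
    rw [← map_sub]
    exact hJle _
  have hJint : Integrable (fun z => J (F z)) μ := by
    refine Integrable.mono' (integrable_finsetSum S fun i _ => hint i.1 i.2)
      hJF.aestronglyMeasurable (Eventually.of_forall fun z => hJle _)
  obtain ⟨g, hg⟩ := J.rangeRestrict.exists_rightInverse_of_surjective J.range_rangeRestrict
  have hJg : ∀ e, J (g e) = (e : _) := fun e => by
    have := LinearMap.congr_fun hg e
    exact congrArg Subtype.val this
  let u₀ : StrongDual ℂ (LinearMap.range J) := (u.toLinearMap ∘ₗ g).mkContinuous C fun e => by
    refine (hle (g e)).trans ?_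
    rw [hJg]; rfl
  obtain ⟨U, hU, -⟩ := exists_extension_norm_eq (LinearMap.range J) u₀
  have hUJ : ∀ h, U (J h) = u h := by
    intro h
    have h1 : U (J h) = u (g ⟨J h, h, rfl⟩) := hU ⟨J h, h, rfl⟩
    rw [h1, ← sub_eq_zero, ← map_sub, ← norm_le_zero_iff]
    refine (hle _).trans ?_
    rw [map_sub, hJg]; simp
  have key : J f = ∫ z, J (F z) ∂μ := by
    refine weightedDerivSpace_ext fun i y => ?_
    rw [← (weightedDerivEval S i y).integral_comp_comm hJint]
    change ‖y‖ ^ i.1.1 • iteratedFDeriv ℝ i.1.2 f y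
      = ∫ z, ‖y‖ ^ i.1.1 • iteratedFDeriv ℝ i.1.2 (F z) y ∂μ
    rw [integral_smul, iteratedFDeriv_eq_integral μ F hF hint f hf]
  rw [← hUJ, key, ← U.integral_comp_comm hJint]
  simp_rw [hUJ]

theorem contDiff_pdGS {d : ℕ} {f : Ed d → ℂ} (hf : ContDiff ℝ ((⊤ : ℕ∞) : WithTop ℕ∞) f)
    (i : Fin d) : ContDiff ℝ ((⊤ : ℕ∞) : WithTop ℕ∞) (pdGS i f) :=
  (hf.fderiv_right (m := ((⊤ : ℕ∞) : WithTop ℕ∞)) le_rfl).clm_apply contDiff_const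

theorem contDiff_iterate_pdGS {d : ℕ} {f : Ed d → ℂ}
    (hf : ContDiff ℝ ((⊤ : ℕ∞) : WithTop ℕ∞) f) (i : Fin d) (n : ℕ) :
    ContDiff ℝ ((⊤ : ℕ∞) : WithTop ℕ∞) ((pdGS i)^[n] f) := by
  induction n generalizing f with
  | zero => exact hf
  | succ n ih => exact ih (contDiff_pdGS hf i)

theorem pdGS_comm {d : ℕ} {f : Ed d → ℂ} (hf : ContDiff ℝ ((⊤ : ℕ∞) : WithTop ℕ∞) f)
    (i j : Fin d) : pdGS i (pdGS j f) = pdGS j (pdGS i f) := by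
  funext x
  have hd : DifferentiableAt ℝ (fderiv ℝ f) x :=
    ((hf.fderiv_right (m := ((⊤ : ℕ∞) : WithTop ℕ∞)) le_rfl).differentiable (by simp)) x
  have key : ∀ a b : Ed d,
      fderiv ℝ (fun y => fderiv ℝ f y a) x b = fderiv ℝ (fderiv ℝ f) x b a := by
    intro a b
    rw [fderiv_clm_apply hd (differentiableAt_const a)]
    simp
  have hsymm : IsSymmSndFDerivAt ℝ f x :=
    (hf.contDiffAt (x := x)).isSymmSndFDerivAt (by
      simp only [minSmoothness_of_isRCLikeNormedField]
      exact WithTop.coe_le_coe.2 (le_top : (2 : ℕ∞) ≤ ⊤))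
  change fderiv ℝ (fun y => fderiv ℝ f y _) x _ = fderiv ℝ (fun y => fderiv ℝ f y _) x _
  rw [key, key]
  exact hsymm _ _

theorem iterate_pdGS_comm {d : ℕ} {f : Ed d → ℂ}
    (hf : ContDiff ℝ ((⊤ : ℕ∞) : WithTop ℕ∞) f) (i j : Fin d) (n : ℕ) :
    (pdGS i)^[n] (pdGS j f) = pdGS j ((pdGS i)^[n] f) := by
  induction n generalizing f with
  | zero => rfl
  | succ n ih =>
    rw [Function.iterate_succ_apply, Function.iterate_succ_apply, pdGS_comm hf,
      ih (contDiff_pdGS hf i)]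

/-- The composition of the operators `(pdGS i)^[β i]` over a list of indices. -/
def listDeriv {d : ℕ} (L : List (Fin d)) (β : Fin d → ℕ) : (Ed d → ℂ) → (Ed d → ℂ) :=
  (L.map fun i => (pdGS i)^[β i]).foldr (· ∘ ·) id

theorem listDeriv_cons {d : ℕ} (a : Fin d) (L : List (Fin d)) (β : Fin d → ℕ) (f : Ed d → ℂ) :
    listDeriv (a :: L) β f = (pdGS a)^[β a] (listDeriv L β f) := rfl

theorem mderiv_eq_listDeriv {d : ℕ} (β : Fin d → ℕ) (f : Ed d → ℂ) :
    mderiv β f = listDeriv (List.finRange d) β f := by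
  rw [mderiv, listDeriv, List.ofFn_eq_map]

theorem contDiff_listDeriv {d : ℕ} {f : Ed d → ℂ}
    (hf : ContDiff ℝ ((⊤ : ℕ∞) : WithTop ℕ∞) f) (L : List (Fin d)) (β : Fin d → ℕ) :
    ContDiff ℝ ((⊤ : ℕ∞) : WithTop ℕ∞) (listDeriv L β f) := by
  induction L with
  | nil => exact hf
  | cons a L ih => exact contDiff_iterate_pdGS ih a _

theorem listDeriv_pdGS {d : ℕ} {f : Ed d → ℂ}
    (hf : ContDiff ℝ ((⊤ : ℕ∞) : WithTop ℕ∞) f) (L : List (Fin d)) (β : Fin d → ℕ) (j : Fin d) :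
    listDeriv L β (pdGS j f) = pdGS j (listDeriv L β f) := by
  induction L with
  | nil => rfl
  | cons a L ih =>
    rw [listDeriv_cons, listDeriv_cons, ih, iterate_pdGS_comm (contDiff_listDeriv hf L β)]

theorem listDeriv_update_of_notMem {d : ℕ} (f : Ed d → ℂ) {L : List (Fin d)} (β : Fin d → ℕ)
    {j : Fin d} (hj : j ∉ L) (m : ℕ) :
    listDeriv L (Function.update β j m) f = listDeriv L β f := by
  induction L with
  | nil => rfl
  | cons a L ih =>
    rw [List.mem_cons, not_or] at hj
    rw [listDeriv_cons, listDeriv_cons, ih hj.2, Function.update_of_ne (Ne.symm hj.1)]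

theorem listDeriv_update {d : ℕ} {f : Ed d → ℂ}
    (hf : ContDiff ℝ ((⊤ : ℕ∞) : WithTop ℕ∞) f) {L : List (Fin d)} (hL : L.Nodup)
    (β : Fin d → ℕ) {j : Fin d} (hj : j ∈ L) :
    listDeriv L (Function.update β j (β j + 1)) f = listDeriv L β (pdGS j f) := by
  induction L with
  | nil => simp at hj
  | cons a L ih =>
    rw [List.nodup_cons] at hL
    rw [listDeriv_cons, listDeriv_cons]
    by_cases hja : j = a
    · subst hja
      rw [listDeriv_update_of_notMem f β hL.1, Function.update_self, listDeriv_pdGS hf,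
        Function.iterate_succ_apply]
    · rw [Function.update_of_ne (Ne.symm hja), ih hL.2 ((List.mem_cons.1 hj).resolve_left hja)]

theorem mderiv_pdGS {d : ℕ} {f : Ed d → ℂ}
    (hf : ContDiff ℝ ((⊤ : ℕ∞) : WithTop ℕ∞) f) (β : Fin d → ℕ) (j : Fin d) :
    mderiv β (pdGS j f) = mderiv (Function.update β j (β j + 1)) f := by
  rw [mderiv_eq_listDeriv, mderiv_eq_listDeriv,
    listDeriv_update hf (List.nodup_finRange d) β (List.mem_finRange j)]

theorem mderiv_zero {d : ℕ} (f : Ed d → ℂ) : mderiv 0 f = f := by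
  rw [mderiv_eq_listDeriv]
  induction List.finRange d with
  | nil => rfl
  | cons a L ih => rw [listDeriv_cons, ih]; rfl

theorem mderiv_single {d : ℕ} {f : Ed d → ℂ}
    (hf : ContDiff ℝ ((⊤ : ℕ∞) : WithTop ℕ∞) f) (j : Fin d) (n : ℕ) :
    mderiv (Pi.single j n) f = (pdGS j)^[n] f := by
  induction n generalizing f with
  | zero => rw [Pi.single_zero, mderiv_zero]; rfl
  | succ n ih =>
    rw [Function.iterate_succ_apply, ← ih (contDiff_pdGS hf j), mderiv_pdGS hf]
    congr 1
    ext i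
    by_cases h : i = j
    · subst h; simp
    · simp [h]

theorem iteratedDeriv_line {d : ℕ} {f : Ed d → ℂ}
    (hf : ContDiff ℝ ((⊤ : ℕ∞) : WithTop ℕ∞) f) (j : Fin d) (y : Ed d) (n : ℕ) :
    iteratedDeriv n (fun t : ℝ => f (y + t • EuclideanSpace.single j (1 : ℝ))) =
      fun t : ℝ => (pdGS j)^[n] f (y + t • EuclideanSpace.single j (1 : ℝ)) := by
  induction n with
  | zero => simp
  | succ n ih =>
    rw [iteratedDeriv_succ, ih]
    funext t
    have h1 : HasDerivAt (fun t : ℝ => y + t • (EuclideanSpace.single j (1 : ℝ) : Ed d))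
        (EuclideanSpace.single j (1 : ℝ)) t := by
      simpa using ((hasDerivAt_id t).smul_const (EuclideanSpace.single j (1 : ℝ) : Ed d)).const_add y
    have h2 := (((contDiff_iterate_pdGS hf j n).differentiable (by simp))
      (y + t • (EuclideanSpace.single j (1 : ℝ) : Ed d))).hasFDerivAt
    rw [Function.iterate_succ_apply']
    exact (h2.comp_hasDerivAt t h1).deriv

theorem iterate_pdGS_eq_iteratedDeriv {d : ℕ} {f : Ed d → ℂ}
    (hf : ContDiff ℝ ((⊤ : ℕ∞) : WithTop ℕ∞) f) (j : Fin d) (y : Ed d) (n : ℕ) :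
    (pdGS j)^[n] f y =
      iteratedDeriv n (fun t : ℝ => f (y + t • EuclideanSpace.single j (1 : ℝ))) 0 := by
  rw [iteratedDeriv_line hf]
  simp

/-- A family of real sequences which is `O(h^n n!^s)`, uniformly in the family, for all `h > 0`. -/
def GSBound {ι : Type*} (s : ℝ) (a : ι → ℕ → ℝ) : Prop :=
  ∀ h : ℝ, 0 < h → ∃ C : ℝ, 0 ≤ C ∧ ∀ i n, a i n ≤ C * h ^ n * (n.factorial : ℝ) ^ s

namespace GSBound

variable {ι κ : Type*} {s : ℝ} {a b : ι → ℕ → ℝ}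

theorem mono (hb : GSBound s b) (hab : ∀ i n, a i n ≤ b i n) : GSBound s a := fun h hh => by
  obtain ⟨C, hC, H⟩ := hb h hh
  exact ⟨C, hC, fun i n => (hab i n).trans (H i n)⟩

theorem reindex (hb : GSBound s b) (e : κ → ι) : GSBound s fun i => b (e i) := fun h hh => by
  obtain ⟨C, hC, H⟩ := hb h hh
  exact ⟨C, hC, fun i n => H (e i) n⟩

theorem add (ha : GSBound s a) (hb : GSBound s b) : GSBound s fun i n => a i n + b i n :=
  fun h hh => by
  obtain ⟨C, hC, H⟩ := ha h hh
  obtain ⟨C', hC', H'⟩ := hb h hh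
  refine ⟨C + C', by positivity, fun i n => ?_⟩
  linarith [H i n, H' i n]

theorem sum {J : Type*} (S : Finset J) {c : J → ι → ℕ → ℝ} (hc : ∀ j ∈ S, GSBound s (c j)) :
    GSBound s fun i n => ∑ j ∈ S, c j i n := by
  classical
  induction S using Finset.induction_on with
  | empty => exact fun h _ => ⟨0, le_rfl, fun i n => by simp⟩
  | insert j S hj ih =>
    simp only [Finset.sum_insert hj]
    exact (hc j (Finset.mem_insert_self _ _)).add
      (ih fun k hk => hc k (Finset.mem_insert_of_mem hk))

theorem pow_mul (hb : GSBound s b) {B M : ℝ} (hB : 0 ≤ B) (hM : 0 ≤ M) :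
    GSBound s fun i n => B * M ^ n * b i n := fun h hh => by
  obtain ⟨C, hC, H⟩ := hb (h / (M + 1)) (by positivity)
  refine ⟨B * C, by positivity, fun i n => ?_⟩
  calc B * M ^ n * b i n
      ≤ B * M ^ n * (C * (h / (M + 1)) ^ n * (n.factorial : ℝ) ^ s) := by gcongr; exact H i n
    _ = B * C * (M * (h / (M + 1))) ^ n * (n.factorial : ℝ) ^ s := by rw [mul_pow]; ring
    _ ≤ B * C * h ^ n * (n.factorial : ℝ) ^ s := by
        gcongr
        rw [mul_div_assoc', div_le_iff₀ (by positivity)]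
        nlinarith

theorem const_mul (hb : GSBound s b) {B : ℝ} (hB : 0 ≤ B) : GSBound s fun i n => B * b i n :=
  (hb.pow_mul hB zero_le_one).mono fun i n => by simp

theorem shift (hs : 0 ≤ s) (hb : GSBound s b) (m : ℕ) : GSBound s fun i n => b i (n + m) :=
  fun h hh => by
  have h2 : (0 : ℝ) < 2 ^ s := by positivity
  obtain ⟨C, hC, H⟩ := hb (h / 2 ^ s) (by positivity)
  refine ⟨C * h ^ m * (m.factorial : ℝ) ^ s, by positivity, fun i n => (H i (n + m)).trans ?_⟩
  have hfac : ((n + m).factorial : ℝ) ≤ 2 ^ (n + m) * (n.factorial * m.factorial) := by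
    rw [← Nat.add_choose_mul_factorial_mul_factorial, Nat.cast_mul, Nat.cast_mul, mul_assoc]
    gcongr
    exact_mod_cast Nat.choose_le_two_pow _ _
  calc C * (h / 2 ^ s) ^ (n + m) * ((n + m).factorial : ℝ) ^ s
      ≤ C * (h / 2 ^ s) ^ (n + m) * (2 ^ (n + m) * (n.factorial * m.factorial)) ^ s := by gcongr
    _ = C * h ^ m * (m.factorial : ℝ) ^ s * h ^ n * (n.factorial : ℝ) ^ s := by
        rw [Real.mul_rpow (by positivity) (by positivity),
          Real.mul_rpow (by positivity) (by positivity), ← Real.rpow_natCast_mul (by norm_num),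
          mul_comm ((n + m : ℕ) : ℝ) s, Real.rpow_mul_natCast (by norm_num), div_pow, pow_add h]
        field_simp

theorem pow (hs : 0 < s) {M : ℝ} (hM : 0 ≤ M) : GSBound s fun (_ : ι) n => M ^ n :=
  fun h hh => by
  set x : ℝ := (M / h) ^ (1 / s) with hx
  have hx0 : 0 ≤ x := by positivity
  have hxs : x ^ s = M / h := by
    rw [hx, ← Real.rpow_mul (by positivity), one_div_mul_cancel hs.ne', Real.rpow_one]
  refine ⟨Real.exp x ^ s, by positivity, fun _ n => ?_⟩
  have h1 : x ^ n ≤ Real.exp x * n.factorial := by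
    have := Real.pow_div_factorial_le_exp x hx0 n
    rwa [div_le_iff₀ (by positivity)] at this
  have h2 := Real.rpow_le_rpow (by positivity) h1 hs.le
  rw [Real.mul_rpow (by positivity) (by positivity), ← Real.rpow_natCast_mul hx0,
    mul_comm (n : ℝ) s, Real.rpow_mul_natCast hx0, hxs, div_pow, div_le_iff₀ (by positivity)] at h2
  linarith

theorem sqrt_factorial (hs : 1 / 2 < s) :
    GSBound s fun (_ : ι) n => (n.factorial : ℝ) ^ (1 / 2 : ℝ) := fun h hh => by
  obtain ⟨C, hC, H⟩ := pow (ι := ι) (s := s - 1 / 2) (by linarith) zero_le_one h hh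
  refine ⟨C, hC, fun i n => ?_⟩
  have := H i n
  have hn : (0 : ℝ) < n.factorial := by positivity
  calc (n.factorial : ℝ) ^ (1 / 2 : ℝ)
      = 1 ^ n * (n.factorial : ℝ) ^ (1 / 2 : ℝ) := by simp
    _ ≤ C * h ^ n * (n.factorial : ℝ) ^ (s - 1 / 2) * (n.factorial : ℝ) ^ (1 / 2 : ℝ) := by gcongr
    _ = C * h ^ n * (n.factorial : ℝ) ^ s := by
        rw [mul_assoc, ← Real.rpow_add hn]; norm_num

theorem conv (hs : 0 ≤ s) {c : κ → ℕ → ℝ} (ha : GSBound s a) (hc : GSBound s c)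
    (hc0 : ∀ i n, 0 ≤ c i n) :
    GSBound s fun (i : ι × κ) n =>
      ∑ k ∈ Finset.range (n + 1), n.choose k * a i.1 k * c i.2 (n - k) := fun h hh => by
  obtain ⟨C, hC, H⟩ := ha (h / 2) (by positivity)
  obtain ⟨C', hC', H'⟩ := hc (h / 2) (by positivity)
  refine ⟨C * C', by positivity, fun i n => ?_⟩
  calc ∑ k ∈ Finset.range (n + 1), n.choose k * a i.1 k * c i.2 (n - k)
      ≤ ∑ k ∈ Finset.range (n + 1),
          n.choose k * (C * C' * (h / 2) ^ n * (n.factorial : ℝ) ^ s) := by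
        refine Finset.sum_le_sum fun k hk => ?_
        have hkn : k ≤ n := Nat.lt_succ_iff.1 (Finset.mem_range.1 hk)
        rw [mul_assoc]
        refine mul_le_mul_of_nonneg_left ?_ (by positivity)
        refine (mul_le_mul (H i.1 k) (H' i.2 (n - k)) (hc0 _ _) (by positivity)).trans ?_
        calc C * (h / 2) ^ k * (k.factorial : ℝ) ^ s *
              (C' * (h / 2) ^ (n - k) * ((n - k).factorial : ℝ) ^ s)
            = C * C' * (h / 2) ^ n * ((k.factorial : ℝ) * ((n - k).factorial : ℝ)) ^ s := by
              rw [Real.mul_rpow (by positivity) (by positivity),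
                ← Nat.add_sub_cancel' hkn, pow_add, Nat.add_sub_cancel_left]
              ring
          _ ≤ _ := by
              gcongr
              exact_mod_cast Nat.le_of_dvd (Nat.factorial_pos _)
                (Nat.factorial_mul_factorial_dvd_factorial hkn)
    _ = C * C' * h ^ n * (n.factorial : ℝ) ^ s := by
        rw [← Finset.sum_mul, ← Nat.cast_sum, Nat.sum_range_choose, div_pow]
        push_cast
        field_simp

theorem one_add_pow_mul (hs : 0 < s) {r t : ι → ℝ} (hr : ∀ i, 0 ≤ r i) (ht : ∀ i, 0 ≤ t i)
    (H : GSBound s fun i n => r i ^ n * t i) :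
    GSBound s fun i n => (1 + r i) ^ n * t i := by
  obtain ⟨C, hC, hC'⟩ := H 1 one_pos
  have h1 := ((GSBound.pow (ι := ι) hs (zero_le_two (α := ℝ))).const_mul hC).add
    (H.pow_mul zero_le_one (zero_le_two (α := ℝ)))
  refine h1.mono fun i n => ?_
  have h2 : (1 + r i) ^ n ≤ 2 ^ n * (1 + r i ^ n) := by
    rcases le_total (r i) 1 with h | h
    · calc (1 + r i) ^ n ≤ 2 ^ n :=
            pow_le_pow_left₀ (by linarith [hr i]) (by linarith) n
        _ ≤ _ := by nlinarith [pow_nonneg (hr i) n, pow_pos (two_pos (α := ℝ)) n]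
    · calc (1 + r i) ^ n ≤ (2 * r i) ^ n :=
            pow_le_pow_left₀ (by linarith [hr i]) (by linarith) n
        _ = 2 ^ n * r i ^ n := mul_pow _ _ _
        _ ≤ _ := by nlinarith [pow_nonneg (hr i) n, pow_pos (two_pos (α := ℝ)) n]
  have h3 : t i ≤ C := by simpa using hC' i 0
  calc (1 + r i) ^ n * t i ≤ 2 ^ n * (1 + r i ^ n) * t i := by gcongr; exact ht i
    _ = t i * 2 ^ n + 1 * 2 ^ n * (r i ^ n * t i) := by ring
    _ ≤ C * 2 ^ n + 1 * 2 ^ n * (r i ^ n * t i) := by gcongr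

end GSBound

/-- A power of a sum of `d` nonnegative reals is controlled by the sum of the powers. -/
theorem sum_pow_le_card_pow_mul {d : ℕ} (a : Fin d → ℝ) (ha : ∀ i, 0 ≤ a i) (n : ℕ) :
    (∑ i, a i) ^ n ≤ (d : ℝ) ^ n * (1 ⊔ ∑ i, a i ^ n) := by
  rcases isEmpty_or_nonempty (Fin d) with hd | hd
  · rcases n.eq_zero_or_pos with rfl | hn
    · simp
    · rw [Finset.univ_eq_empty, Finset.sum_empty, zero_pow hn.ne']
      positivity
  · obtain ⟨j, hj⟩ := Finite.exists_max a
    calc (∑ i, a i) ^ n ≤ (d * a j) ^ n := by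
          refine pow_le_pow_left₀ (Finset.sum_nonneg fun i _ => ha i) ?_ n
          simpa using Finset.sum_le_card_nsmul Finset.univ a (a j) fun i _ => hj i
      _ = d ^ n * a j ^ n := mul_pow _ _ _
      _ ≤ _ := by
        gcongr
        exact le_sup_of_le_right (Finset.single_le_sum (f := fun i => a i ^ n)
          (fun i _ => pow_nonneg (ha i) n) (Finset.mem_univ j))

theorem norm_le_sum_abs {d : ℕ} (y : Ed d) : ‖y‖ ≤ ∑ i, |y i| := by
  conv_lhs => rw [← (EuclideanSpace.basisFun (Fin d) ℝ).sum_repr y]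
  refine (norm_sum_le _ _).trans (Finset.sum_le_sum fun i _ => ?_)
  rw [norm_smul]
  simp

theorem norm_pow_le_sum {d : ℕ} (y : Ed d) (n : ℕ) :
    ‖y‖ ^ n ≤ (d : ℝ) ^ n * (1 + ∑ i, |y i| ^ n) := by
  refine (pow_le_pow_left₀ (norm_nonneg _) (norm_le_sum_abs y) n).trans
    ((sum_pow_le_card_pow_mul _ (fun i => abs_nonneg _) n).trans ?_)
  have : 0 ≤ ∑ i, |y i| ^ n := Finset.sum_nonneg fun i _ => by positivity
  gcongr
  exact sup_le (by linarith) (by linarith)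

theorem exists_le_of_mem_SigmaGS {d : ℕ} {s : ℝ} {f : Ed d → ℂ} (hf : f ∈ SigmaGS s d) {h : ℝ}
    (hh : 0 < h) : ∃ C : ℝ, 0 ≤ C ∧ ∀ x α β, |mpow x α| * ‖mderiv β f x‖ ≤
      C * (h ^ (mlen α + mlen β) * ((mfact α : ℝ) * (mfact β : ℝ)) ^ s) := by
  refine ⟨(GSnorm s h f).toReal, ENNReal.toReal_nonneg, fun x α β => ?_⟩
  have h1 : ENNReal.ofReal (|mpow x α| * ‖mderiv β f x‖ /
      (h ^ (mlen α + mlen β) * ((mfact α : ℝ) * (mfact β : ℝ)) ^ s)) ≤ GSnorm s h f := by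
    rw [GSnorm]
    exact le_iSup_of_le x (le_iSup_of_le α (le_iSup_of_le β le_rfl))
  rw [ENNReal.ofReal_le_iff_le_toReal (hf.2 h hh).ne] at h1
  have hα : 0 < mfact α := Finset.prod_pos fun i _ => Nat.factorial_pos _
  have hβ : 0 < mfact β := Finset.prod_pos fun i _ => Nat.factorial_pos _
  rwa [div_le_iff₀ (by positivity)] at h1

theorem mpow_single {d : ℕ} (x : Ed d) (i : Fin d) (n : ℕ) : mpow x (Pi.single i n) = x i ^ n := by
  rw [mpow, Finset.prod_eq_single i] <;> simp +contextual

theorem mlen_single {d : ℕ} (i : Fin d) (n : ℕ) : mlen (Pi.single i n) = n := by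
  rw [mlen, Finset.sum_pi_single']
  simp

theorem mfact_single {d : ℕ} (i : Fin d) (n : ℕ) : mfact (Pi.single i n) = n.factorial := by
  rw [mfact, Finset.prod_eq_single i] <;> simp +contextual

theorem gsBound_coord_pow_mul {d : ℕ} {s : ℝ} {f : Ed d → ℂ} (hf : f ∈ SigmaGS s d) (i : Fin d) :
    GSBound s fun (y : Ed d) n => |y i| ^ n * ‖f y‖ := fun h hh => by
  obtain ⟨C, hC, H⟩ := exists_le_of_mem_SigmaGS hf hh
  refine ⟨C, hC, fun y n => ?_⟩
  have := H y (Pi.single i n) 0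
  rw [mderiv_zero, mpow_single, mlen_single, mfact_single, abs_pow] at this
  simpa [mlen, mfact, mul_assoc] using this

theorem gsBound_pow_mul_norm {d : ℕ} {s : ℝ} (hs : 0 < s) {f : Ed d → ℂ} (hf : f ∈ SigmaGS s d) :
    GSBound s fun (y : Ed d) n => (1 + ‖y‖) ^ n * ‖f y‖ := by
  refine GSBound.one_add_pow_mul hs (fun y => norm_nonneg y) (fun y => norm_nonneg _) ?_
  have h0 : GSBound s fun (y : Ed d) (_ : ℕ) => ‖f y‖ := by
    intro h hh
    obtain ⟨C, hC, H⟩ := exists_le_of_mem_SigmaGS hf one_pos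
    obtain ⟨C', hC', H'⟩ := GSBound.pow (ι := Unit) hs zero_le_one h hh
    refine ⟨C * C', by positivity, fun y n => ?_⟩
    have h1 := H y 0 0
    rw [mderiv_zero] at h1
    have h2 : ‖f y‖ ≤ C := by simpa [mlen, mfact, mpow] using h1
    have h3 := H' () n
    simp only [one_pow] at h3
    calc ‖f y‖ ≤ C * 1 := by simpa using h2
      _ ≤ C * (C' * h ^ n * (n.factorial : ℝ) ^ s) := by gcongr
      _ = _ := by ring
  have h1 := (h0.add (GSBound.sum Finset.univ fun i _ => gsBound_coord_pow_mul hf i)).pow_mul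
    zero_le_one (Nat.cast_nonneg (α := ℝ) d)
  refine h1.mono fun y n => ?_
  calc ‖y‖ ^ n * ‖f y‖ ≤ (d : ℝ) ^ n * (1 + ∑ i, |y i| ^ n) * ‖f y‖ := by
        gcongr; exact norm_pow_le_sum y n
    _ = _ := by rw [one_mul, mul_assoc, add_mul, one_mul, Finset.sum_mul]

theorem one_add_norm_pow_le {d : ℕ} (D : ℕ) : ∃ B : ℝ, 0 ≤ B ∧ ∀ y : Ed d,
    (1 + ‖y‖) ^ D ≤ B * (1 + ∑ i, |y i| ^ D) := by
  refine ⟨2 ^ D * (1 + d ^ D), by positivity, fun y => ?_⟩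
  have h0 : 0 ≤ ∑ i, |y i| ^ D := Finset.sum_nonneg fun i _ => by positivity
  have h1 : (1 + ‖y‖) ^ D ≤ 2 ^ D * (1 + ‖y‖ ^ D) := by
    rcases le_total ‖y‖ 1 with h | h
    · calc (1 + ‖y‖) ^ D ≤ 2 ^ D := pow_le_pow_left₀ (by positivity) (by linarith) D
        _ ≤ _ := by
          nlinarith [pow_nonneg (norm_nonneg y) D, pow_pos (two_pos (α := ℝ)) D]
    · calc (1 + ‖y‖) ^ D ≤ (2 * ‖y‖) ^ D := pow_le_pow_left₀ (by positivity) (by linarith) D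
        _ = 2 ^ D * ‖y‖ ^ D := mul_pow _ _ _
        _ ≤ _ := by nlinarith [pow_nonneg (norm_nonneg y) D, pow_pos (two_pos (α := ℝ)) D]
  calc (1 + ‖y‖) ^ D ≤ 2 ^ D * (1 + ‖y‖ ^ D) := h1
    _ ≤ 2 ^ D * ((1 + ∑ i, |y i| ^ D) + (d : ℝ) ^ D * (1 + ∑ i, |y i| ^ D)) := by
        gcongr
        · linarith
        · exact norm_pow_le_sum y D
    _ = _ := by ring

theorem gsBound_weight_mul_deriv {d : ℕ} {s : ℝ} {f : Ed d → ℂ} (hf : f ∈ SigmaGS s d) (D : ℕ) :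
    GSBound s fun (p : Ed d × Fin d) n => (1 + ‖p.1‖) ^ D * ‖(pdGS p.2)^[n] f p.1‖ := by
  obtain ⟨B, hB, hBy⟩ := one_add_norm_pow_le (d := d) D
  have key : ∀ (i : Fin d) (k : ℕ), GSBound s fun (p : Ed d × Fin d) n =>
      |p.1 i| ^ k * ‖(pdGS p.2)^[n] f p.1‖ := by
    intro i k h hh
    obtain ⟨C, hC, H⟩ := exists_le_of_mem_SigmaGS hf hh
    refine ⟨C * h ^ k * (k.factorial : ℝ) ^ s, by positivity, fun p n => ?_⟩
    have := H p.1 (Pi.single i k) (Pi.single p.2 n)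
    rw [mderiv_single hf.1, mpow_single, mlen_single, mlen_single, mfact_single, mfact_single,
      abs_pow, Real.mul_rpow (by positivity) (by positivity), pow_add] at this
    refine this.trans (le_of_eq ?_)
    ring
  have key0 : GSBound s fun (p : Ed d × Fin d) n => ‖(pdGS p.2)^[n] f p.1‖ := by
    intro h hh
    obtain ⟨C, hC, H⟩ := exists_le_of_mem_SigmaGS hf hh
    refine ⟨C, hC, fun p n => ?_⟩
    have := H p.1 0 (Pi.single p.2 n)
    rw [mderiv_single hf.1, mlen_single, mfact_single] at this
    simpa [mpow, mlen, mfact, mul_assoc] using this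
  refine ((key0.add (GSBound.sum Finset.univ fun i _ => key i D)).const_mul hB).mono fun p n => ?_
  calc (1 + ‖p.1‖) ^ D * ‖(pdGS p.2)^[n] f p.1‖
      ≤ B * (1 + ∑ i, |p.1 i| ^ D) * ‖(pdGS p.2)^[n] f p.1‖ := by gcongr; exact hBy p.1
    _ = _ := by rw [mul_assoc, add_mul, one_mul, Finset.sum_mul]

theorem norm_iteratedFDeriv_succ_le_sum {d : ℕ} {f : Ed d → ℂ}
    (hf : ContDiff ℝ ((⊤ : ℕ∞) : WithTop ℕ∞) f) (n : ℕ) (x : Ed d) :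
    ‖iteratedFDeriv ℝ (n + 1) f x‖ ≤ ∑ i, ‖iteratedFDeriv ℝ n (pdGS i f) x‖ := by
  have hrepr : fderiv ℝ f = fun y => ∑ i : Fin d,
      (ContinuousLinearMap.smulRightL ℝ (Ed d) ℂ (EuclideanSpace.proj i : Ed d →L[ℝ] ℝ))
        (pdGS i f y) := by
    funext y
    ext v
    conv_lhs => rw [← (EuclideanSpace.basisFun (Fin d) ℝ).sum_repr v]
    simp [pdGS, map_sum]
  rw [← norm_iteratedFDeriv_fderiv, hrepr]
  have hsmooth : ∀ i : Fin d, ContDiff ℝ n fun y =>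
      (ContinuousLinearMap.smulRightL ℝ (Ed d) ℂ (EuclideanSpace.proj i : Ed d →L[ℝ] ℝ))
        (pdGS i f y) := fun i =>
    (ContinuousLinearMap.contDiff _).comp
      ((contDiff_pdGS hf i).of_le (WithTop.coe_le_coe.2 le_top))
  rw [iteratedFDeriv_fun_sum_apply fun i _ => (hsmooth i).contDiffAt]
  refine (norm_sum_le _ _).trans (Finset.sum_le_sum fun i _ => ?_)
  have hpd : ContDiff ℝ n (pdGS i f) :=
    (contDiff_pdGS hf i).of_le (WithTop.coe_le_coe.2 le_top)
  refine (ContinuousLinearMap.norm_iteratedFDeriv_comp_left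
    (ContinuousLinearMap.smulRightL ℝ (Ed d) ℂ (EuclideanSpace.proj i : Ed d →L[ℝ] ℝ))
    hpd.contDiffAt le_rfl).trans ?_
  refine mul_le_of_le_one_left (norm_nonneg _) ?_
  refine ContinuousLinearMap.opNorm_le_bound _ zero_le_one fun c => ?_
  change ‖ContinuousLinearMap.smulRight (EuclideanSpace.proj i : Ed d →L[ℝ] ℝ) c‖ ≤ 1 * ‖c‖
  rw [ContinuousLinearMap.norm_smulRight_apply]
  gcongr
  refine ContinuousLinearMap.opNorm_le_bound _ zero_le_one fun v => ?_
  rw [one_mul]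
  exact PiLp.norm_apply_le v i

theorem decay_iteratedFDeriv {d : ℕ} {f : Ed d → ℂ}
    (hf : ContDiff ℝ ((⊤ : ℕ∞) : WithTop ℕ∞) f)
    (H : ∀ (β : Fin d → ℕ) (k : ℕ), ∃ C : ℝ, ∀ x, ‖x‖ ^ k * ‖mderiv β f x‖ ≤ C) (k n : ℕ) :
    ∃ C : ℝ, ∀ x, ‖x‖ ^ k * ‖iteratedFDeriv ℝ n f x‖ ≤ C := by
  induction n generalizing f with
  | zero =>
    obtain ⟨C, hC⟩ := H 0 k
    exact ⟨C, fun x => by simpa [mderiv_zero] using hC x⟩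
  | succ n ih =>
    have h1 : ∀ i : Fin d, ∃ C : ℝ, ∀ x, ‖x‖ ^ k * ‖iteratedFDeriv ℝ n (pdGS i f) x‖ ≤ C :=
      fun i => ih (contDiff_pdGS hf i) fun β k => by
        rw [mderiv_pdGS hf]
        exact H _ k
    choose C hC using h1
    refine ⟨∑ i, C i, fun x => ?_⟩
    calc ‖x‖ ^ k * ‖iteratedFDeriv ℝ (n + 1) f x‖
        ≤ ‖x‖ ^ k * ∑ i, ‖iteratedFDeriv ℝ n (pdGS i f) x‖ := by
          gcongr; exact norm_iteratedFDeriv_succ_le_sum hf n x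
      _ ≤ _ := by
          rw [Finset.mul_sum]
          exact Finset.sum_le_sum fun i _ => hC i x

/-- A function in the Gelfand–Shilov space, as a Schwartz function. -/
def schwartzOfSigmaGS {d : ℕ} {s : ℝ} {f : Ed d → ℂ} (hf : f ∈ SigmaGS s d) :
    SchwartzMap (Ed d) ℂ where
  toFun := f
  smooth' := hf.1
  decay' := decay_iteratedFDeriv hf.1 fun β k => by
    obtain ⟨C, hC, H⟩ := exists_le_of_mem_SigmaGS hf one_pos
    obtain ⟨B, hB, hBy⟩ := one_add_norm_pow_le (d := d) k
    refine ⟨B * (C * (mfact β : ℝ) ^ s + ∑ _i : Fin d, C * (k.factorial * mfact β : ℝ) ^ s),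
      fun x => ?_⟩
    have h0 : ‖mderiv β f x‖ ≤ C * (mfact β : ℝ) ^ s := by
      simpa [mpow, mlen, mfact] using H x 0 β
    have h1 : ∀ i : Fin d, |x i| ^ k * ‖mderiv β f x‖ ≤ C * (k.factorial * mfact β : ℝ) ^ s := by
      intro i
      simpa [mpow_single, mfact_single] using H x (Pi.single i k) β
    calc ‖x‖ ^ k * ‖mderiv β f x‖ ≤ (B * (1 + ∑ i, |x i| ^ k)) * ‖mderiv β f x‖ := by
          gcongr
          exact (pow_le_pow_left₀ (norm_nonneg x) (by linarith) k).trans (hBy x)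
      _ = B * (‖mderiv β f x‖ + ∑ i, |x i| ^ k * ‖mderiv β f x‖) := by
          rw [mul_assoc, add_mul, one_mul, Finset.sum_mul]
      _ ≤ _ := mul_le_mul_of_nonneg_left
          (add_le_add h0 (Finset.sum_le_sum fun i _ => h1 i)) hB

@[simp]
theorem schwartzOfSigmaGS_apply {d : ℕ} {s : ℝ} {f : Ed d → ℂ} (hf : f ∈ SigmaGS s d) (x : Ed d) :
    schwartzOfSigmaGS hf x = f x := rfl

theorem qf_nonneg {d : ℕ} {R : Matrix (Fin d) (Fin d) ℝ} (hR : R.PosSemidef) (x : Ed d) :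
    0 ≤ qf R x := by
  have h := hR.dotProduct_mulVec_nonneg (fun i => x i)
  refine h.trans (le_of_eq ?_)
  simp only [dotProduct, Matrix.mulVec, qf, star_trivial]
  exact Finset.sum_congr rfl fun i _ => mul_comm _ _

theorem qf_add_smul_single {d : ℕ} (R : Matrix (Fin d) (Fin d) ℝ) (x : Ed d) (j : Fin d) (t : ℝ) :
    qf R (x + t • EuclideanSpace.single j (1 : ℝ)) =
      qf R x + (∑ k, R j k * x k + ∑ i, R i j * x i) * t + R j j * t ^ 2 := by
  have h1 : ∀ k, (x + t • (EuclideanSpace.single j (1 : ℝ) : Ed d)) k =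
      x k + if k = j then t else 0 := by
    intro k
    simp
  simp only [qf, h1, mul_add, Finset.sum_add_distrib, mul_ite, mul_zero, Finset.sum_ite_eq',
    Finset.mem_univ, if_true, add_mul, Finset.sum_mul]
  rw [pow_two]
  have : ∀ i, R i j * t * x i = R i j * x i * t := fun i => by ring
  simp only [this]
  ring

theorem hasTemperateGrowth_qf {d : ℕ} (R : Matrix (Fin d) (Fin d) ℝ) :
    (qf R).HasTemperateGrowth := by
  have h : ∀ i : Fin d, (fun x : Ed d => x i).HasTemperateGrowth := fun i =>
    (EuclideanSpace.proj i : Ed d →L[ℝ] ℝ).hasTemperateGrowth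
  unfold qf
  fun_prop

/-- The Gaussian `e^{-⟨Rx, x⟩}`. -/
def gaussianOf {d : ℕ} (R : Matrix (Fin d) (Fin d) ℝ) (y : Ed d) : ℂ :=
  ((Real.exp (-(qf R y)) : ℝ) : ℂ)

open Set in
theorem hasTemperateGrowth_gaussianOf {d : ℕ} {R : Matrix (Fin d) (Fin d) ℝ}
    (hR : R.PosSemidef) : (gaussianOf R).HasTemperateGrowth := by
  have hs : ContDiff ℝ ((⊤ : ℕ∞) : WithTop ℕ∞) fun x : ℝ => Real.exp (-x) := by fun_prop
  have h : ((fun x : ℝ => Real.exp (-x)) ∘ qf R).HasTemperateGrowth := by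
    refine Function.HasTemperateGrowth.comp' (t := Ici 0) ?_ (uniqueDiffOn_Ici 0) hs.contDiffOn ?_
      (hasTemperateGrowth_qf R)
    · rintro _ ⟨x, rfl⟩
      exact qf_nonneg hR x
    · refine fun N => ⟨0, 1, zero_le_one, fun n _ x hx => ?_⟩
      rw [iteratedFDerivWithin_eq_iteratedFDeriv (uniqueDiffOn_Ici 0)
        (hs.contDiffAt.of_le (WithTop.coe_le_coe.2 le_top)) hx,
        norm_iteratedFDeriv_eq_norm_iteratedDeriv, iteratedDeriv_comp_neg, iteratedDeriv_eq_iterate,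
        Real.iter_deriv_exp]
      simpa using hx
  exact Function.HasTemperateGrowth.comp Function.Complex.hasTemperateGrowth_ofReal h

theorem iteratedDeriv_comp_ofReal {G : ℂ → ℂ} (hG : Differentiable ℂ G) (n : ℕ) (t : ℝ) :
    iteratedDeriv n (fun x : ℝ => G x) t = iteratedDeriv n G t := by
  induction n generalizing t with
  | zero => simp
  | succ n ih =>
    have h : iteratedDeriv n (fun x : ℝ => G x) = fun x : ℝ => iteratedDeriv n G x := funext ih
    rw [iteratedDeriv_succ, iteratedDeriv_succ, h]
    have hd : DifferentiableAt ℂ (iteratedDeriv n G) t :=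
      (hG.contDiff (n := ⊤)).differentiable_iteratedDeriv n (WithTop.coe_lt_top _) t
    exact hd.hasDerivAt.comp_ofReal.deriv

theorem norm_iteratedDeriv_gaussian_le {q b c : ℝ} (hc : 0 ≤ c)
    (hq : ∀ t : ℝ, 0 ≤ q + b * t + c * t ^ 2) (n : ℕ) :
    ‖iteratedDeriv n (fun t : ℝ => ((Real.exp (-(q + b * t + c * t ^ 2)) : ℝ) : ℂ)) 0‖ ≤
      Real.exp c ^ n * (n.factorial : ℝ) ^ (1 / 2 : ℝ) := by
  set G : ℂ → ℂ := fun z => Complex.exp (-(q + b * z + c * z ^ 2)) with hG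
  have hGd : Differentiable ℂ G := by fun_prop
  have h1 : (fun t : ℝ => ((Real.exp (-(q + b * t + c * t ^ 2)) : ℝ) : ℂ)) = fun t : ℝ => G t := by
    funext t
    simp [hG]
  have h2 : ∀ z : ℂ, ‖G z‖ ≤ Real.exp (c * ‖z‖ ^ 2) := by
    intro z
    rw [hG, Complex.norm_exp, Real.exp_le_exp]
    have hre : (-(q + b * z + c * z ^ 2) : ℂ).re =
        -(q + b * z.re + c * z.re ^ 2) + c * z.im ^ 2 := by
      simp [pow_two]
      ring
    have him : z.im ^ 2 ≤ ‖z‖ ^ 2 := by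
      rw [← sq_abs z.im]
      exact pow_le_pow_left₀ (abs_nonneg _) (Complex.abs_im_le_norm z) 2
    rw [hre]
    nlinarith [hq z.re, mul_le_mul_of_nonneg_left him hc]
  rw [h1, iteratedDeriv_comp_ofReal hGd, Complex.ofReal_zero]
  rcases n.eq_zero_or_pos with rfl | hn
  · simpa using h2 0
  have hr : 0 < Real.sqrt n := by positivity
  have h3 := Complex.norm_iteratedDeriv_le_of_forall_mem_sphere_norm_le (C := Real.exp (c * n))
    (c := 0) n hr hGd.diffContOnCl (fun z hz => by
      refine (h2 z).trans (le_of_eq ?_)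
      rw [mem_sphere_zero_iff_norm.1 hz, Real.sq_sqrt (by positivity)])
  refine h3.trans ?_
  rw [div_le_iff₀ (by positivity), mul_comm c, Real.exp_nat_mul]
  have h4 : (n.factorial : ℝ) ≤ (n.factorial : ℝ) ^ (1 / 2 : ℝ) * Real.sqrt n ^ n := by
    have h5 : (n.factorial : ℝ) ^ (1 / 2 : ℝ) ≤ Real.sqrt n ^ n := by
      rw [← Real.sqrt_eq_rpow]
      refine Real.sqrt_le_iff.2 ⟨by positivity, ?_⟩
      rw [← pow_mul, mul_comm n 2, pow_mul, Real.sq_sqrt (by positivity)]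
      exact_mod_cast Nat.factorial_le_pow n
    calc (n.factorial : ℝ) = (n.factorial : ℝ) ^ (1 / 2 : ℝ) * (n.factorial : ℝ) ^ (1 / 2 : ℝ) := by
          rw [← Real.rpow_add (by positivity)]; norm_num
      _ ≤ _ := by gcongr
  nlinarith [pow_pos (Real.exp_pos c) n]

theorem gsBound_gaussianOf {d : ℕ} {s : ℝ} (hs : 1 / 2 < s) {R : Matrix (Fin d) (Fin d) ℝ}
    (hR : R.PosSemidef) :
    GSBound s fun (p : Ed d × Fin d) n => ‖(pdGS p.2)^[n] (gaussianOf R) p.1‖ := by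
  set c := ∑ j, R j j with hc
  have hdiag : ∀ j, 0 ≤ R j j := fun j => hR.diag_nonneg
  refine ((GSBound.sqrt_factorial (ι := Ed d × Fin d) hs).pow_mul zero_le_one
    (Real.exp_pos c).le).mono ?_
  rintro ⟨y, j⟩ n
  rw [iterate_pdGS_eq_iteratedDeriv (hasTemperateGrowth_gaussianOf hR).1]
  have hfun : (fun t : ℝ => gaussianOf R (y + t • EuclideanSpace.single j (1 : ℝ))) = fun t : ℝ =>
      ((Real.exp (-(qf R y + (∑ k, R j k * y k + ∑ i, R i j * y i) * t + R j j * t ^ 2)) : ℝ) :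
        ℂ) := by
    funext t
    rw [gaussianOf, qf_add_smul_single]
  rw [hfun, one_mul]
  refine (norm_iteratedDeriv_gaussian_le (hdiag j) (fun t => ?_) n).trans ?_
  · rw [← qf_add_smul_single]
    exact qf_nonneg hR _
  · gcongr
    exact Finset.single_le_sum (f := fun j => R j j) (fun i _ => hdiag i) (Finset.mem_univ j)

open Topology SchwartzMap in
/-- A locally bounded family of Schwartz functions depending smoothly on a parameter is continuous
for the Schwartz topology. -/
theorem continuous_schwartz_of_contDiff_of_bounded {Z E : Type*} [NormedAddCommGroup Z]
    [NormedSpace ℝ Z] [NormedAddCommGroup E] [NormedSpace ℝ E] [ProperSpace E]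
    (F : Z → 𝓢(E, ℂ)) (Φ : Z × E → ℂ) (hΦ : ContDiff ℝ ((⊤ : ℕ∞) : WithTop ℕ∞) Φ)
    (hF : ∀ z y, F z y = Φ (z, y))
    (hb : ∀ (k l : ℕ) (z₀ : Z), ∃ M : ℝ, ∀ᶠ z in 𝓝 z₀, SchwartzMap.seminorm ℂ k l (F z) ≤ M) :
    Continuous F := by
  have hderiv : ∀ (l : ℕ) (z : Z) (y : E), iteratedFDeriv ℝ l (F z) y =
      (iteratedFDeriv ℝ l Φ (z, y)).compContinuousLinearMap
        fun _ => ContinuousLinearMap.inr ℝ Z E := by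
    intro l z y
    have h1 : ⇑(F z) = (fun w : Z × E => Φ ((z, 0) + w)) ∘ ContinuousLinearMap.inr ℝ Z E := by
      funext y
      simp [hF]
    have h2 : ContDiff ℝ l fun w : Z × E => Φ ((z, 0) + w) :=
      (hΦ.of_le (WithTop.coe_le_coe.2 le_top)).comp (contDiff_const.add contDiff_id)
    rw [h1, ContinuousLinearMap.iteratedFDeriv_comp_right _ h2 y le_rfl,
      iteratedFDeriv_comp_add_left]
    simp
  have hcont : ∀ l : ℕ, Continuous fun p : Z × E => iteratedFDeriv ℝ l (F p.1) p.2 := by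
    intro l
    simp only [hderiv]
    exact (ContinuousMultilinearMap.compContinuousLinearMapL
      (fun _ : Fin l => ContinuousLinearMap.inr ℝ Z E)).continuous.comp
        (hΦ.continuous_iteratedFDeriv (WithTop.coe_le_coe.2 le_top))
  rw [continuous_iff_continuousAt]
  intro z₀
  refine ((schwartz_withSeminorms ℂ E ℂ).tendsto_nhds F (F z₀)).2 fun kl ε hε => ?_
  obtain ⟨k, l⟩ := kl
  obtain ⟨M, hM⟩ := hb (k + 1) l z₀
  have hM0 : 0 ≤ M := (apply_nonneg _ _).trans hM.self_of_nhds
  set ρ : ℝ := 4 * M / ε + 1 with hρ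
  have hρ0 : 0 < ρ := by positivity
  have hloc : ∀ᶠ z in 𝓝 z₀, ∀ y ∈ Metric.closedBall (0 : E) ρ,
      ‖y‖ ^ k * ‖iteratedFDeriv ℝ l (F z) y - iteratedFDeriv ℝ l (F z₀) y‖ < ε / 2 := by
    refine (isCompact_closedBall (0 : E) ρ).eventually_forall_of_forall_eventually
      (P := fun z y => ‖y‖ ^ k *
        ‖iteratedFDeriv ℝ l (F z) y - iteratedFDeriv ℝ l (F z₀) y‖ < ε / 2) fun y _ => ?_
    have hc : Continuous fun p : Z × E => ‖p.2‖ ^ k *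
        ‖iteratedFDeriv ℝ l (F p.1) p.2 - iteratedFDeriv ℝ l (F z₀) p.2‖ := by
      refine (continuous_snd.norm.pow k).mul ((hcont l).sub ?_).norm
      exact (hcont l).comp (continuous_const.prodMk continuous_snd)
    refine hc.continuousAt.eventually_lt continuousAt_const ?_
    simp only [sub_self, norm_zero, mul_zero]
    positivity
  filter_upwards [hM, hloc] with z hz hzloc
  refine lt_of_le_of_lt ?_ (half_lt_self hε)
  refine SchwartzMap.seminorm_le_bound ℂ k l _ (by positivity) fun y => ?_
  have hsub : iteratedFDeriv ℝ l (⇑(F z - F z₀)) y =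
      iteratedFDeriv ℝ l (F z) y - iteratedFDeriv ℝ l (F z₀) y := by
    have : ⇑(F z - F z₀) = ⇑(F z) - ⇑(F z₀) := rfl
    rw [this, iteratedFDeriv_sub_apply ((F z).smooth l).contDiffAt ((F z₀).smooth l).contDiffAt]
  rw [hsub]
  by_cases hy : y ∈ Metric.closedBall (0 : E) ρ
  · exact (hzloc y hy).le
  · have hyρ : ρ < ‖y‖ := by simpa using hy
    have h1 := SchwartzMap.le_seminorm ℂ (k + 1) l (F z) y
    have h2 := SchwartzMap.le_seminorm ℂ (k + 1) l (F z₀) y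
    have h3 : ‖y‖ * (‖y‖ ^ k * ‖iteratedFDeriv ℝ l (F z) y - iteratedFDeriv ℝ l (F z₀) y‖) ≤
        2 * M := by
      calc ‖y‖ * (‖y‖ ^ k * ‖iteratedFDeriv ℝ l (F z) y - iteratedFDeriv ℝ l (F z₀) y‖)
          ≤ ‖y‖ * (‖y‖ ^ k * (‖iteratedFDeriv ℝ l (F z) y‖ + ‖iteratedFDeriv ℝ l (F z₀) y‖)) := by
            gcongr; exact norm_sub_le _ _
        _ = ‖y‖ ^ (k + 1) * ‖iteratedFDeriv ℝ l (F z) y‖ +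
            ‖y‖ ^ (k + 1) * ‖iteratedFDeriv ℝ l (F z₀) y‖ := by ring
        _ ≤ 2 * M := by linarith [hM.self_of_nhds]
    have h4 : 4 * M / ε ≤ ‖y‖ := by linarith
    rw [div_le_iff₀ hε] at h4
    have h5 : ‖y‖ * (‖y‖ ^ k * ‖iteratedFDeriv ℝ l (F z) y - iteratedFDeriv ℝ l (F z₀) y‖) ≤
        ‖y‖ * (ε / 2) := by linarith
    exact le_of_mul_le_mul_left h5 (hρ0.trans hyρ)

/-- The character `y ↦ e^{-i⟨y, ξ⟩}`. -/
def charFn {d : ℕ} (ξ y : Ed d) : ℂ := Complex.exp (-(Complex.I * (⟪y, ξ⟫ : ℝ)))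

theorem norm_charFn {d : ℕ} (ξ y : Ed d) : ‖charFn ξ y‖ = 1 := by
  rw [charFn, Complex.norm_exp]
  simp

theorem contDiff_charFn {d : ℕ} :
    ContDiff ℝ ((⊤ : ℕ∞) : WithTop ℕ∞) fun p : Ed d × Ed d => charFn p.1 p.2 := by
  have h : ContDiff ℝ ((⊤ : ℕ∞) : WithTop ℕ∞) fun p : Ed d × Ed d => ((⟪p.2, p.1⟫ : ℝ) : ℂ) :=
    Complex.ofRealCLM.contDiff.comp (contDiff_snd.inner ℝ contDiff_fst)
  exact (contDiff_const.mul h).neg.cexp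

theorem norm_iteratedFDeriv_charFn_le {d : ℕ} (ξ y : Ed d) (n : ℕ) :
    ‖iteratedFDeriv ℝ n (charFn ξ) y‖ ≤ ‖ξ‖ ^ n := by
  set E : ℝ → ℂ := fun t => Complex.exp (-Complex.I * t) with hE
  have hcd : ContDiff ℝ n E := (contDiff_const.mul Complex.ofRealCLM.contDiff).cexp
  have h1 : charFn ξ = E ∘ (innerSL ℝ ξ) := by
    funext y
    simp [hE, charFn, real_inner_comm]
  rw [h1, ContinuousLinearMap.iteratedFDeriv_comp_right _ hcd y le_rfl]
  refine (ContinuousMultilinearMap.norm_compContinuousLinearMap_le _ _).trans ?_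
  have h2 : ‖iteratedFDeriv ℝ n E (innerSL ℝ ξ y)‖ = 1 := by
    rw [norm_iteratedFDeriv_eq_norm_iteratedDeriv, hE,
      iteratedDeriv_comp_ofReal (G := fun z => Complex.exp (-Complex.I * z)) (by fun_prop),
      iteratedDeriv_cexp_const_mul]
    simp [Complex.norm_exp]
  rw [h2, one_mul]
  simp

open SchwartzMap in
/-- The time-frequency shift `y ↦ conj (f (y - x)) e^{-i⟨y, ξ⟩}`, as a bare function. -/
def atomFn {d : ℕ} (f : 𝓢(Ed d, ℂ)) (z : Ed d × Ed d) (y : Ed d) : ℂ :=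
  (starRingEnd ℂ) (f (y - z.1)) * charFn z.2 y

open SchwartzMap in
theorem contDiff_atomFn {d : ℕ} (f : 𝓢(Ed d, ℂ)) :
    ContDiff ℝ ((⊤ : ℕ∞) : WithTop ℕ∞) fun p : (Ed d × Ed d) × Ed d => atomFn f p.1 p.2 := by
  have h1 : ContDiff ℝ ((⊤ : ℕ∞) : WithTop ℕ∞) fun p : (Ed d × Ed d) × Ed d => f (p.2 - p.1.1) :=
    (f.smooth ⊤).comp (contDiff_snd.sub (contDiff_fst.comp contDiff_fst))
  have h2 : ContDiff ℝ ((⊤ : ℕ∞) : WithTop ℕ∞)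
      fun p : (Ed d × Ed d) × Ed d => (starRingEnd ℂ) (f (p.2 - p.1.1)) :=
    ContDiff.comp (g := fun z : ℂ => (starRingEnd ℂ) z) Complex.conjCLE.contDiff h1
  have h3 : ContDiff ℝ ((⊤ : ℕ∞) : WithTop ℕ∞)
      fun p : (Ed d × Ed d) × Ed d => charFn p.1.2 p.2 :=
    ContDiff.comp (g := fun q : Ed d × Ed d => charFn q.1 q.2)
      (f := fun p : (Ed d × Ed d) × Ed d => (p.1.2, p.2)) contDiff_charFn
      (ContDiff.prodMk (contDiff_snd.comp contDiff_fst) contDiff_snd)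
  exact h2.mul h3

open SchwartzMap in
theorem exists_norm_iteratedFDeriv_atomFn_le {d : ℕ} (f : 𝓢(Ed d, ℂ)) (k n : ℕ) :
    ∃ C : ℝ, 0 ≤ C ∧ ∀ z y, ‖y‖ ^ k * ‖iteratedFDeriv ℝ n (atomFn f z) y‖ ≤
      C * (1 + ‖z‖) ^ (k + n) := by
  set S := 2 ^ k * (Finset.Iic (k, n)).sup (fun m => SchwartzMap.seminorm ℂ m.1 m.2) f with hS
  have hS0 : 0 ≤ S := by positivity
  refine ⟨∑ i ∈ Finset.range (n + 1), n.choose i * S, by positivity, fun z y => ?_⟩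
  have hsm : ContDiff ℝ n fun y => (starRingEnd ℂ) (f (y - z.1)) :=
    Complex.conjCLE.contDiff.comp ((f.smooth n).comp (contDiff_id.sub contDiff_const))
  have hch : ContDiff ℝ n (charFn z.2) :=
    (contDiff_charFn.comp (contDiff_const.prodMk contDiff_id)).of_le
      (WithTop.coe_le_coe.2 le_top)
  have hconj : ∀ i, ‖iteratedFDeriv ℝ i (fun y => (starRingEnd ℂ) (f (y - z.1))) y‖ =
      ‖iteratedFDeriv ℝ i f (y - z.1)‖ := by
    intro i
    rw [← iteratedFDeriv_comp_sub]
    exact Complex.conjLIE.norm_iteratedFDeriv_comp_left (fun y => f (y - z.1)) y i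
  have hz1 : ‖z.1‖ ≤ ‖z‖ := norm_fst_le z
  have hz2 : ‖z.2‖ ≤ ‖z‖ := norm_snd_le z
  have hy : ‖y‖ ^ k ≤ (1 + ‖y - z.1‖) ^ k * (1 + ‖z‖) ^ k := by
    rw [← mul_pow]
    refine pow_le_pow_left₀ (norm_nonneg _) ?_ k
    have : ‖y‖ ≤ ‖y - z.1‖ + ‖z.1‖ := by simpa using norm_add_le (y - z.1) z.1
    nlinarith [norm_nonneg (y - z.1), norm_nonneg z]
  calc ‖y‖ ^ k * ‖iteratedFDeriv ℝ n (atomFn f z) y‖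
      ≤ ‖y‖ ^ k * ∑ i ∈ Finset.range (n + 1), n.choose i *
          ‖iteratedFDeriv ℝ i f (y - z.1)‖ * ‖iteratedFDeriv ℝ (n - i) (charFn z.2) y‖ := by
        gcongr
        have h := norm_iteratedFDeriv_mul_le hsm hch y le_rfl
        simp only [hconj] at h
        exact h
    _ ≤ ((1 + ‖y - z.1‖) ^ k * (1 + ‖z‖) ^ k) * ∑ i ∈ Finset.range (n + 1), n.choose i *
          ‖iteratedFDeriv ℝ i f (y - z.1)‖ * (1 + ‖z‖) ^ n := by
        gcongr with i hi
        calc ‖iteratedFDeriv ℝ (n - i) (charFn z.2) y‖ ≤ ‖z.2‖ ^ (n - i) :=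
              norm_iteratedFDeriv_charFn_le _ _ _
          _ ≤ (1 + ‖z‖) ^ (n - i) := by gcongr; linarith
          _ ≤ (1 + ‖z‖) ^ n := by
              gcongr
              · linarith [norm_nonneg z]
              · omega
    _ = ∑ i ∈ Finset.range (n + 1), n.choose i *
          ((1 + ‖y - z.1‖) ^ k * ‖iteratedFDeriv ℝ i f (y - z.1)‖) * (1 + ‖z‖) ^ (k + n) := by
        rw [Finset.mul_sum]
        refine Finset.sum_congr rfl fun i _ => ?_
        rw [pow_add]
        ring
    _ ≤ ∑ i ∈ Finset.range (n + 1), n.choose i * S * (1 + ‖z‖) ^ (k + n) := by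
        gcongr with i hi
        exact SchwartzMap.one_add_le_sup_seminorm_apply (m := (k, n)) le_rfl
          (Nat.lt_succ_iff.1 (Finset.mem_range.1 hi)) f _
    _ = _ := by rw [Finset.sum_mul]

open SchwartzMap in
/-- The time-frequency shift `y ↦ conj (f (y - x)) e^{-i⟨y, ξ⟩}` of a Schwartz function. -/
def atom {d : ℕ} (f : 𝓢(Ed d, ℂ)) (z : Ed d × Ed d) : 𝓢(Ed d, ℂ) where
  toFun := atomFn f z
  smooth' := (contDiff_atomFn f).comp (contDiff_const.prodMk contDiff_id)
  decay' k n := by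
    obtain ⟨C, -, hC⟩ := exists_norm_iteratedFDeriv_atomFn_le f k n
    exact ⟨_, hC z⟩

open SchwartzMap in
theorem atom_apply {d : ℕ} (f : 𝓢(Ed d, ℂ)) (z : Ed d × Ed d) (y : Ed d) :
    atom f z y = (starRingEnd ℂ) (f (y - z.1)) * charFn z.2 y := rfl

open SchwartzMap in
theorem exists_seminorm_atom_le {d : ℕ} (f : 𝓢(Ed d, ℂ)) (k n : ℕ) :
    ∃ C : ℝ, 0 ≤ C ∧ ∀ z, SchwartzMap.seminorm ℂ k n (atom f z) ≤ C * (1 + ‖z‖) ^ (k + n) := by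
  obtain ⟨C, hC0, hC⟩ := exists_norm_iteratedFDeriv_atomFn_le f k n
  exact ⟨C, hC0, fun z => SchwartzMap.seminorm_le_bound ℂ k n _ (by positivity) (hC z)⟩

open SchwartzMap in
theorem continuous_atom {d : ℕ} (f : 𝓢(Ed d, ℂ)) : Continuous (atom f) := by
  refine continuous_schwartz_of_contDiff_of_bounded (atom f) _ (contDiff_atomFn f)
    (fun _ _ => rfl) fun k l z₀ => ?_
  obtain ⟨C, hC0, hC⟩ := exists_seminorm_atom_le f k l
  refine ⟨C * (1 + (‖z₀‖ + 1)) ^ (k + l), ?_⟩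
  filter_upwards [Metric.ball_mem_nhds z₀ one_pos] with z hz
  refine (hC z).trans ?_
  have : ‖z‖ ≤ ‖z₀‖ + 1 := by
    have h1 : ‖z‖ ≤ ‖z₀‖ + ‖z - z₀‖ := by simpa using norm_add_le z₀ (z - z₀)
    have h2 : ‖z - z₀‖ < 1 := by rwa [← dist_eq_norm]
    linarith
  gcongr

open SchwartzMap in
theorem exists_norm_apply_atom_le {d : ℕ} (u : TD d) (f : 𝓢(Ed d, ℂ)) :
    ∃ (C : ℝ) (N : ℕ), 0 ≤ C ∧ ∀ z, ‖u (atom f z)‖ ≤ C * (1 + ‖z‖) ^ N := by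
  obtain ⟨S, C, hC⟩ := Seminorm.bound_of_continuous (schwartz_withSeminorms ℂ (Ed d) ℂ)
    ((normSeminorm ℂ ℂ).comp u.toLinearMap) (by
      change Continuous fun x => ‖u x‖
      exact u.continuous.norm)
  choose B hB0 hB using fun m : ℕ × ℕ => exists_seminorm_atom_le f m.1 m.2
  refine ⟨C * ∑ m ∈ S, B m, ∑ m ∈ S, (m.1 + m.2), by
    have := Finset.sum_nonneg fun m (_ : m ∈ S) => hB0 m
    positivity, fun z => ?_⟩
  have h1 : ‖u (atom f z)‖ ≤ C * (S.sup (schwartzSeminormFamily ℂ (Ed d) ℂ)) (atom f z) :=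
    hC.2 (atom f z)
  have h2 : (S.sup (schwartzSeminormFamily ℂ (Ed d) ℂ)) (atom f z) ≤
      ∑ m ∈ S, B m * (1 + ‖z‖) ^ (∑ m ∈ S, (m.1 + m.2)) := by
    refine (Seminorm.finset_sup_apply_le (Finset.sum_nonneg fun m _ => by
      have := hB0 m; positivity) fun m hm => ?_)
    calc schwartzSeminormFamily ℂ (Ed d) ℂ m (atom f z) ≤ B m * (1 + ‖z‖) ^ (m.1 + m.2) := hB m z
      _ ≤ B m * (1 + ‖z‖) ^ (∑ m ∈ S, (m.1 + m.2)) := by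
        have := hB0 m
        gcongr
        · linarith [norm_nonneg z]
        · exact Finset.single_le_sum (f := fun m : ℕ × ℕ => m.1 + m.2) (fun _ _ => Nat.zero_le _) hm
      _ ≤ _ := Finset.single_le_sum
        (f := fun m => B m * (1 + ‖z‖) ^ (∑ m ∈ S, (m.1 + m.2)))
        (fun m _ => by have := hB0 m; positivity) hm
  calc ‖u (atom f z)‖ ≤ C * (S.sup (schwartzSeminormFamily ℂ (Ed d) ℂ)) (atom f z) := h1
    _ ≤ C * ∑ m ∈ S, B m * (1 + ‖z‖) ^ (∑ m ∈ S, (m.1 + m.2)) := by gcongr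
    _ = _ := by rw [← Finset.sum_mul, mul_assoc]

theorem norm_iterate_pdGS_mul_le {d : ℕ} {f g : Ed d → ℂ}
    (hf : ContDiff ℝ ((⊤ : ℕ∞) : WithTop ℕ∞) f) (hg : ContDiff ℝ ((⊤ : ℕ∞) : WithTop ℕ∞) g)
    (j : Fin d) (y : Ed d) (n : ℕ) :
    ‖(pdGS j)^[n] (fun t => f t * g t) y‖ ≤ ∑ k ∈ Finset.range (n + 1),
      n.choose k * ‖(pdGS j)^[k] f y‖ * ‖(pdGS j)^[n - k] g y‖ := by
  have hline : ContDiff ℝ ((⊤ : ℕ∞) : WithTop ℕ∞)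
      fun t : ℝ => y + t • EuclideanSpace.single j (1 : ℝ) :=
    contDiff_const.add (contDiff_id.smul contDiff_const)
  have hfl : ContDiff ℝ n fun t : ℝ => f (y + t • EuclideanSpace.single j (1 : ℝ)) :=
    (hf.comp hline).of_le (WithTop.coe_le_coe.2 le_top)
  have hgl : ContDiff ℝ n fun t : ℝ => g (y + t • EuclideanSpace.single j (1 : ℝ)) :=
    (hg.comp hline).of_le (WithTop.coe_le_coe.2 le_top)
  simp only [iterate_pdGS_eq_iteratedDeriv (hf.mul hg), iterate_pdGS_eq_iteratedDeriv hf,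
    iterate_pdGS_eq_iteratedDeriv hg]
  rw [iteratedDeriv_fun_mul hfl.contDiffAt hgl.contDiffAt]
  refine (norm_sum_le _ _).trans (Finset.sum_le_sum fun k _ => ?_)
  simp

theorem iterate_pdGS_comp_sub {d : ℕ} {f : Ed d → ℂ}
    (hf : ContDiff ℝ ((⊤ : ℕ∞) : WithTop ℕ∞) f) (j : Fin d) (a y : Ed d) (n : ℕ) :
    (pdGS j)^[n] (fun t => f (t - a)) y = (pdGS j)^[n] f (y - a) := by
  have hfa : ContDiff ℝ ((⊤ : ℕ∞) : WithTop ℕ∞) fun t => f (t - a) :=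
    hf.comp (contDiff_id.sub contDiff_const)
  rw [iterate_pdGS_eq_iteratedDeriv hfa, iterate_pdGS_eq_iteratedDeriv hf]
  simp only [add_sub_right_comm]

theorem norm_iterate_pdGS_conj {d : ℕ} {f : Ed d → ℂ}
    (hf : ContDiff ℝ ((⊤ : ℕ∞) : WithTop ℕ∞) f) (j : Fin d) (y : Ed d) (n : ℕ) :
    ‖(pdGS j)^[n] (fun t => (starRingEnd ℂ) (f t)) y‖ = ‖(pdGS j)^[n] f y‖ := by
  have hc : ContDiff ℝ ((⊤ : ℕ∞) : WithTop ℕ∞) fun t => (starRingEnd ℂ) (f t) :=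
    ContDiff.comp (g := fun z : ℂ => (starRingEnd ℂ) z) Complex.conjCLE.contDiff hf
  rw [iterate_pdGS_eq_iteratedDeriv hc, iterate_pdGS_eq_iteratedDeriv hf,
    ← norm_iteratedFDeriv_eq_norm_iteratedDeriv, ← norm_iteratedFDeriv_eq_norm_iteratedDeriv]
  exact Complex.conjLIE.norm_iteratedFDeriv_comp_left
    (fun t : ℝ => f (y + t • EuclideanSpace.single j (1 : ℝ))) 0 n

open SchwartzMap LineDeriv in
theorem iterate_lineDerivOp_apply {d : ℕ} (f : 𝓢(Ed d, ℂ)) (j : Fin d) (n : ℕ) :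
    ⇑((fun g : 𝓢(Ed d, ℂ) => ∂_{EuclideanSpace.single j (1 : ℝ)} g)^[n] f) =
      (pdGS j)^[n] f := by
  induction n with
  | zero => rfl
  | succ n ih =>
    rw [Function.iterate_succ_apply', Function.iterate_succ_apply', ← ih]
    rfl

open SchwartzMap LineDeriv FourierTransform in
theorem norm_fourier_iterate_lineDerivOp {d : ℕ} (f : 𝓢(Ed d, ℂ)) (j : Fin d) (n : ℕ) (ζ : Ed d) :
    ‖𝓕 ((fun g : 𝓢(Ed d, ℂ) => ∂_{EuclideanSpace.single j (1 : ℝ)} g)^[n] f) ζ‖ =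
      (2 * Real.pi * |ζ j|) ^ n * ‖𝓕 f ζ‖ := by
  induction n with
  | zero => simp
  | succ n ih =>
    have ht : (fun y : Ed d => inner ℝ y (EuclideanSpace.single j (1 : ℝ))).HasTemperateGrowth :=
      ((innerSL ℝ).flip (EuclideanSpace.single j (1 : ℝ))).hasTemperateGrowth
    rw [Function.iterate_succ_apply', fourier_lineDerivOp_eq, smul_apply,
      smulLeftCLM_apply_apply ht, norm_smul, norm_smul, ih]
    simp [Real.pi_nonneg, abs_of_nonneg, EuclideanSpace.inner_single_right]
    ring

open SchwartzMap FourierTransform in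
theorem norm_fourier_le_integral_norm {d : ℕ} (f : 𝓢(Ed d, ℂ)) (ζ : Ed d) :
    ‖𝓕 f ζ‖ ≤ ∫ t, ‖f t‖ := by
  rw [fourier_coe]
  exact VectorFourier.norm_fourierIntegral_le_integral_norm _ _ _ _ _

open SchwartzMap FourierTransform in
theorem abs_coord_pow_mul_norm_fourier_le {d : ℕ} (f : 𝓢(Ed d, ℂ)) (j : Fin d) (n : ℕ)
    (ζ : Ed d) : |ζ j| ^ n * ‖𝓕 f ζ‖ ≤ ∫ t, ‖(pdGS j)^[n] f t‖ := by
  rw [← iterate_lineDerivOp_apply]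
  refine le_trans ?_ (norm_fourier_le_integral_norm _ ζ)
  rw [norm_fourier_iterate_lineDerivOp]
  gcongr
  nlinarith [Real.pi_gt_three, abs_nonneg (ζ j)]

open SchwartzMap in
/-- The function `t ↦ e^{-⟨Rt, t⟩} conj (w (t - x)) φ (t - p)`. -/
def localizedProduct {d : ℕ} (R : Matrix (Fin d) (Fin d) ℝ) (w φ : 𝓢(Ed d, ℂ)) (x p : Ed d) :
    𝓢(Ed d, ℂ) :=
  pairing (ContinuousLinearMap.mul ℂ ℂ) (smulLeftCLM ℂ (gaussianOf R) (atom w (x, 0)))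
    (compSubConstCLM ℂ p φ)

open SchwartzMap in
theorem localizedProduct_apply {d : ℕ} {R : Matrix (Fin d) (Fin d) ℝ} (hR : R.PosSemidef)
    (w φ : 𝓢(Ed d, ℂ)) (x p t : Ed d) :
    localizedProduct R w φ x p t =
      gaussianOf R t * ((starRingEnd ℂ) (w (t - x)) * φ (t - p)) := by
  rw [localizedProduct, pairing_apply_apply, smulLeftCLM_apply_apply (hasTemperateGrowth_gaussianOf hR),
    atom_apply]
  simp [charFn, mul_assoc]

theorem norm_gaussianOf_le_one {d : ℕ} {R : Matrix (Fin d) (Fin d) ℝ} (hR : R.PosSemidef)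
    (y : Ed d) : ‖gaussianOf R y‖ ≤ 1 := by
  rw [gaussianOf, Complex.norm_real, Real.norm_of_nonneg (Real.exp_pos _).le, Real.exp_le_one_iff]
  linarith [qf_nonneg hR y]

theorem GSBound.integral {d : ℕ} {ι : Type*} {s : ℝ} (c : ι → Ed d) {a : ι × Ed d → ℕ → ℝ}
    (ha : ∀ i n, 0 ≤ a i n)
    (H : GSBound s fun (i : ι × Ed d) n => (1 + ‖i.2 - c i.1‖) ^ (d + 1) * a i n) :
    GSBound s fun i n => ∫ t, a (i, t) n := by
  intro h hh
  obtain ⟨C, hC, hCa⟩ := H h hh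
  set I := ∫ t : Ed d, (1 + ‖t‖) ^ (-((d : ℝ) + 1)) with hI
  have hint : Integrable fun t : Ed d => (1 + ‖t‖) ^ (-((d : ℝ) + 1)) :=
    integrable_one_add_norm (by simp)
  have hI0 : 0 ≤ I := integral_nonneg fun t => by positivity
  refine ⟨C * I, by positivity, fun i n => ?_⟩
  calc ∫ t, a (i, t) n
      ≤ ∫ t, C * h ^ n * (n.factorial : ℝ) ^ s * (1 + ‖t - c i‖) ^ (-((d : ℝ) + 1)) := by
        refine integral_mono_of_nonneg (Eventually.of_forall fun t => ha _ _)
          ((hint.comp_sub_right (c i)).const_mul _) (Eventually.of_forall fun t => ?_)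
        have h1 := hCa (i, t) n
        have h2 : 0 < 1 + ‖t - c i‖ := by positivity
        have h3 : (1 + ‖t - c i‖) ^ (-((d : ℝ) + 1)) = ((1 + ‖t - c i‖) ^ (d + 1))⁻¹ := by
          rw [Real.rpow_neg h2.le, ← Real.rpow_natCast]
          push_cast
          rfl
        simp only [h3]
        rw [← div_eq_mul_inv, le_div_iff₀ (by positivity), mul_comm]
        exact h1
    _ = C * I * h ^ n * (n.factorial : ℝ) ^ s := by
        rw [integral_const_mul, integral_sub_right_eq_self (fun t : Ed d =>
          (1 + ‖t‖) ^ (-((d : ℝ) + 1))) (c i)]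
        ring

open SchwartzMap in
theorem gsBound_weight_mul_deriv_localizedProduct {d : ℕ} {s : ℝ} (hs : 1 / 2 < s)
    {R : Matrix (Fin d) (Fin d) ℝ} (hR : R.PosSemidef) {w φ : Ed d → ℂ} (hw : w ∈ SigmaGS s d)
    (hφ : φ ∈ SigmaGS s d) :
    GSBound s fun (i : (Ed d × Ed d × Fin d) × Ed d) n =>
      (1 + ‖i.2 - i.1.1‖) ^ (d + 1) * ‖(pdGS i.1.2.2)^[n]
        (localizedProduct R (schwartzOfSigmaGS hw) (schwartzOfSigmaGS hφ) i.1.1 i.1.2.1) i.2‖ := by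
  have hs0 : 0 ≤ s := by linarith
  have h1 := (gsBound_weight_mul_deriv hw (d + 1)).conv hs0 (gsBound_weight_mul_deriv hφ 0)
    (fun i n => by positivity)
  have hnn : ∀ (i : (Ed d × Fin d) × (Ed d × Fin d)) (n : ℕ),
      0 ≤ ∑ k ∈ Finset.range (n + 1), n.choose k *
        ((1 + ‖i.1.1‖) ^ (d + 1) * ‖(pdGS i.1.2)^[k] w i.1.1‖) *
        ((1 + ‖i.2.1‖) ^ 0 * ‖(pdGS i.2.2)^[n - k] φ i.2.1‖) := fun i n => by positivity
  have h2 := ((gsBound_gaussianOf hs hR).conv hs0 h1 hnn).reindex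
    (fun i : (Ed d × Ed d × Fin d) × Ed d =>
      ((i.2, i.1.2.2), ((i.2 - i.1.1, i.1.2.2), (i.2 - i.1.2.1, i.1.2.2))))
  refine h2.mono ?_
  rintro ⟨⟨x, p, j⟩, t⟩ n
  simp only [pow_zero, one_mul]
  have hg := (hasTemperateGrowth_gaussianOf hR).1
  have hwc : ContDiff ℝ ((⊤ : ℕ∞) : WithTop ℕ∞) fun t => w (t - x) :=
    hw.1.comp (contDiff_id.sub contDiff_const)
  have hwx : ContDiff ℝ ((⊤ : ℕ∞) : WithTop ℕ∞) fun t => (starRingEnd ℂ) (w (t - x)) :=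
    ContDiff.comp (g := fun z : ℂ => (starRingEnd ℂ) z) Complex.conjCLE.contDiff hwc
  have hφp : ContDiff ℝ ((⊤ : ℕ∞) : WithTop ℕ∞) fun t => φ (t - p) :=
    hφ.1.comp (contDiff_id.sub contDiff_const)
  have hfun : ⇑(localizedProduct R (schwartzOfSigmaGS hw) (schwartzOfSigmaGS hφ) x p) =
      fun t => gaussianOf R t * ((starRingEnd ℂ) (w (t - x)) * φ (t - p)) := by
    funext t
    simp [localizedProduct_apply hR]
  rw [hfun]
  calc (1 + ‖t - x‖) ^ (d + 1) * ‖(pdGS j)^[n]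
        (fun t => gaussianOf R t * ((starRingEnd ℂ) (w (t - x)) * φ (t - p))) t‖
      ≤ (1 + ‖t - x‖) ^ (d + 1) * ∑ k ∈ Finset.range (n + 1), n.choose k *
          ‖(pdGS j)^[k] (gaussianOf R) t‖ * ∑ l ∈ Finset.range (n - k + 1), (n - k).choose l *
            ‖(pdGS j)^[l] w (t - x)‖ * ‖(pdGS j)^[n - k - l] φ (t - p)‖ := by
        gcongr
        refine (norm_iterate_pdGS_mul_le hg (hwx.mul hφp) j t n).trans ?_
        gcongr with k hk
        refine (norm_iterate_pdGS_mul_le hwx hφp j t (n - k)).trans (le_of_eq ?_)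
        refine Finset.sum_congr rfl fun l _ => ?_
        rw [norm_iterate_pdGS_conj hwc, iterate_pdGS_comp_sub hw.1, iterate_pdGS_comp_sub hφ.1]
    _ = _ := by
        rw [Finset.mul_sum]
        refine Finset.sum_congr rfl fun k _ => ?_
        rw [mul_left_comm, Finset.mul_sum]
        congr 1
        refine Finset.sum_congr rfl fun l _ => ?_
        ring

theorem gsBound_pow_mul_localizedProduct {d : ℕ} {s : ℝ} (hs : 0 < s)
    {R : Matrix (Fin d) (Fin d) ℝ} (hR : R.PosSemidef) {w φ : Ed d → ℂ} (hw : w ∈ SigmaGS s d)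
    (hφ : φ ∈ SigmaGS s d) :
    GSBound s fun (i : (Ed d × Ed d) × Ed d) n =>
      (1 + ‖i.2 - i.1.1‖) ^ (d + 1) * ((1 + ‖i.1.2 - i.1.1‖) ^ n *
        ‖localizedProduct R (schwartzOfSigmaGS hw) (schwartzOfSigmaGS hφ) i.1.1 i.1.2 i.2‖) := by
  have hW := gsBound_pow_mul_norm hs hw
  have hΦ := gsBound_pow_mul_norm hs hφ
  obtain ⟨A, hA, hAw⟩ := (hW.shift hs.le (d + 1)) 1 one_pos
  obtain ⟨B, hB, hBφ⟩ := hΦ 1 one_pos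
  have h1 := (((hW.shift hs.le (d + 1)).reindex fun i : (Ed d × Ed d) × Ed d => i.2 - i.1.1).pow_mul
    hB zero_le_two).add ((hΦ.reindex fun i : (Ed d × Ed d) × Ed d => i.2 - i.1.2).pow_mul
    hA zero_le_two)
  refine h1.mono ?_
  rintro ⟨⟨x, p⟩, t⟩ n
  have hA' := hAw (t - x) 0
  have hB' := hBφ (t - p) 0
  simp only [localizedProduct_apply hR, schwartzOfSigmaGS_apply, pow_zero, one_mul, mul_one,
    Nat.factorial_zero, Nat.cast_one, Real.one_rpow, zero_add] at hA' hB' ⊢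
  set X := 1 + ‖t - x‖
  set P := 1 + ‖t - p‖
  have hX : 1 ≤ X := by simp [X]
  have hP : 1 ≤ P := by simp [P]
  have hpx : (1 + ‖p - x‖) ^ n ≤ 2 ^ n * X ^ n + 2 ^ n * P ^ n := by
    have h3 : 1 + ‖p - x‖ ≤ X + P := by
      have : ‖p - x‖ ≤ ‖t - x‖ + ‖t - p‖ := by
        calc ‖p - x‖ = ‖(t - x) - (t - p)‖ := by congr 1; abel
          _ ≤ _ := norm_sub_le _ _
      simp only [X, P]; linarith
    rcases le_total X P with h | h
    · calc (1 + ‖p - x‖) ^ n ≤ (2 * P) ^ n := pow_le_pow_left₀ (by positivity) (by linarith) n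
        _ ≤ _ := by rw [mul_pow]; linarith [show 0 ≤ 2 ^ n * X ^ n by positivity]
    · calc (1 + ‖p - x‖) ^ n ≤ (2 * X) ^ n := pow_le_pow_left₀ (by positivity) (by linarith) n
        _ ≤ _ := by rw [mul_pow]; linarith [show 0 ≤ 2 ^ n * P ^ n by positivity]
  have hF : ‖gaussianOf R t * ((starRingEnd ℂ) (w (t - x)) * φ (t - p))‖ ≤
      ‖w (t - x)‖ * ‖φ (t - p)‖ := by
    rw [norm_mul, norm_mul, RCLike.norm_conj]
    exact mul_le_of_le_one_left (by positivity) (norm_gaussianOf_le_one hR t)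
  calc X ^ (d + 1) * ((1 + ‖p - x‖) ^ n *
        ‖gaussianOf R t * ((starRingEnd ℂ) (w (t - x)) * φ (t - p))‖)
      ≤ X ^ (d + 1) * ((2 ^ n * X ^ n + 2 ^ n * P ^ n) * (‖w (t - x)‖ * ‖φ (t - p)‖)) := by
        gcongr
    _ = 2 ^ n * (X ^ (n + (d + 1)) * ‖w (t - x)‖) * ‖φ (t - p)‖ +
        (X ^ (d + 1) * ‖w (t - x)‖) * (2 ^ n * (P ^ n * ‖φ (t - p)‖)) := by
        rw [pow_add X n]; ring
    _ ≤ 2 ^ n * (X ^ (n + (d + 1)) * ‖w (t - x)‖) * B +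
        A * (2 ^ n * (P ^ n * ‖φ (t - p)‖)) := by
        refine add_le_add (mul_le_mul_of_nonneg_left hB' (by positivity))
          (mul_le_mul_of_nonneg_right hA' (by positivity))
    _ = _ := by ring

open SchwartzMap FourierTransform in
/-- The kernel relating the short-time Fourier transforms of `u` and of `e^{-⟨R·, ·⟩} u`. -/
def gaussianKernel {d : ℕ} (R : Matrix (Fin d) (Fin d) ℝ) (w φ : 𝓢(Ed d, ℂ)) (x : Ed d)
    (q : Ed d × Ed d) : ℂ :=
  𝓕 (localizedProduct R w φ x q.1) q.2

theorem gsBound_gaussianKernel {d : ℕ} {s : ℝ} (hs : 1 / 2 < s) {R : Matrix (Fin d) (Fin d) ℝ}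
    (hR : R.PosSemidef) {w φ : Ed d → ℂ} (hw : w ∈ SigmaGS s d) (hφ : φ ∈ SigmaGS s d) :
    GSBound s fun (i : Ed d × (Ed d × Ed d)) n => (1 + ‖i.2 - (i.1, 0)‖) ^ n *
      ‖gaussianKernel R (schwartzOfSigmaGS hw) (schwartzOfSigmaGS hφ) i.1 i.2‖ := by
  have hs0 : 0 < s := by linarith
  set K := gaussianKernel R (schwartzOfSigmaGS hw) (schwartzOfSigmaGS hφ) with hK
  have h1 : GSBound s fun (i : Ed d × (Ed d × Ed d)) n =>
      (1 + ‖i.2.1 - i.1‖) ^ n * ‖K i.1 i.2‖ := by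
    refine ((GSBound.integral (fun i : Ed d × Ed d => i.1) (fun i n => by positivity)
      (gsBound_pow_mul_localizedProduct hs0 hR hw hφ)).reindex
        fun i : Ed d × (Ed d × Ed d) => (i.1, i.2.1)).mono ?_
    rintro ⟨x, p, ζ⟩ n
    simp only
    rw [integral_const_mul]
    gcongr
    exact norm_fourier_le_integral_norm _ _
  have h0 : GSBound s fun (i : Ed d × (Ed d × Ed d)) (n : ℕ) => ‖K i.1 i.2‖ := by
    refine h1.mono fun i n => le_mul_of_one_le_left (norm_nonneg _) (one_le_pow₀ ?_)
    simp
  have h2 : ∀ j : Fin d, GSBound s fun (i : Ed d × (Ed d × Ed d)) n =>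
      |i.2.2 j| ^ n * ‖K i.1 i.2‖ := by
    intro j
    refine ((GSBound.integral (fun i : Ed d × Ed d × Fin d => i.1) (fun i n => norm_nonneg _)
      (gsBound_weight_mul_deriv_localizedProduct hs hR hw hφ)).reindex
        fun i : Ed d × (Ed d × Ed d) => (i.1, i.2.1, j)).mono ?_
    rintro ⟨x, p, ζ⟩ n
    exact abs_coord_pow_mul_norm_fourier_le _ j n ζ
  have h3 : GSBound s fun (i : Ed d × (Ed d × Ed d)) n => ‖i.2.2‖ ^ n * ‖K i.1 i.2‖ := by
    refine ((h0.add (GSBound.sum Finset.univ fun j _ => h2 j)).pow_mul zero_le_one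
      (Nat.cast_nonneg d)).mono fun i n => ?_
    calc ‖i.2.2‖ ^ n * ‖K i.1 i.2‖
        ≤ (d : ℝ) ^ n * (1 + ∑ j, |i.2.2 j| ^ n) * ‖K i.1 i.2‖ := by
          gcongr; exact norm_pow_le_sum _ _
      _ = _ := by rw [one_mul, mul_assoc, add_mul, one_mul, Finset.sum_mul]
  have h4 := GSBound.one_add_pow_mul hs0 (fun _ => norm_nonneg _) (fun _ => norm_nonneg _) h3
  refine (h1.add h4).mono ?_
  rintro ⟨x, p, ζ⟩ n
  rw [← add_mul]
  gcongr
  simp only [Prod.mk_sub_mk, sub_zero, Prod.norm_mk]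
  rcases le_total ‖p - x‖ ‖ζ‖ with h | h
  · rw [sup_eq_right.2 h]; linarith [show 0 ≤ (1 + ‖p - x‖) ^ n by positivity]
  · rw [sup_eq_left.2 h]; linarith [show 0 ≤ (1 + ‖ζ‖) ^ n by positivity]

open SchwartzMap FourierTransform in
theorem continuous_gaussianKernel {d : ℕ} {R : Matrix (Fin d) (Fin d) ℝ} (hR : R.PosSemidef)
    (w φ : 𝓢(Ed d, ℂ)) (x : Ed d) : Continuous (gaussianKernel R w φ x) := by
  have hK : gaussianKernel R w φ x = fun q : Ed d × Ed d =>
      ∫ t, Complex.exp (↑(-2 * Real.pi * ⟪t, q.2⟫) * Complex.I) •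
        (gaussianOf R t * ((starRingEnd ℂ) (w (t - x)) * φ (t - q.1))) := by
    funext q
    rw [gaussianKernel, fourier_coe, Real.fourier_eq']
    simp only [localizedProduct_apply hR]
  have hg : Continuous (gaussianOf R) := (hasTemperateGrowth_gaussianOf hR).1.continuous
  rw [hK]
  refine continuous_of_dominated (bound := fun t => ‖atom w (x, 0) t‖ *
    SchwartzMap.seminorm ℂ 0 0 φ) (fun q => ?_) (fun q => Eventually.of_forall fun t => ?_)
    ((atom w (x, 0)).integrable.norm.mul_const _) (Eventually.of_forall fun t => ?_)
  · refine Continuous.aestronglyMeasurable ?_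
    have := w.continuous
    have := φ.continuous
    fun_prop
  · have h1 : ‖φ (t - q.1)‖ ≤ SchwartzMap.seminorm ℂ 0 0 φ := φ.norm_le_seminorm ℂ _
    have h2 := norm_gaussianOf_le_one hR t
    rw [norm_smul, Complex.norm_exp_ofReal_mul_I, one_mul, norm_mul, norm_mul, atom_apply,
      norm_mul, norm_charFn, mul_one]
    calc ‖gaussianOf R t‖ * (‖(starRingEnd ℂ) (w (t - x))‖ * ‖φ (t - q.1)‖)
        ≤ 1 * (‖(starRingEnd ℂ) (w (t - x))‖ * SchwartzMap.seminorm ℂ 0 0 φ) := by gcongr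
      _ = _ := one_mul _
  · have := φ.continuous
    fun_prop

theorem isAddHaarMeasure_volume_prod (d : ℕ) :
    (volume : Measure (Ed d × Ed d)).IsAddHaarMeasure := by
  rw [Measure.volume_eq_prod]
  infer_instance

theorem integrable_one_add_norm_sub_inv_pow {d : ℕ} (x : Ed d) :
    Integrable fun q : Ed d × Ed d => ((1 + ‖q - (x, 0)‖) ^ (2 * d + 1))⁻¹ := by
  have := isAddHaarMeasure_volume_prod d
  have h : Integrable fun q : Ed d × Ed d => (1 + ‖q‖) ^ (-((2 * d + 1 : ℕ) : ℝ)) := by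
    refine integrable_one_add_norm ?_
    rw [Module.finrank_prod]
    simp only [finrank_euclideanSpace, Fintype.card_fin]
    push_cast
    linarith
  refine (h.comp_sub_right (x, 0)).congr (Eventually.of_forall fun q => ?_)
  simp only
  rw [Real.rpow_neg (by positivity), Real.rpow_natCast]

theorem exists_gaussianKernel_le {d : ℕ} {s : ℝ} (hs : 1 / 2 < s) {R : Matrix (Fin d) (Fin d) ℝ}
    (hR : R.PosSemidef) {w φ : Ed d → ℂ} (hw : w ∈ SigmaGS s d) (hφ : φ ∈ SigmaGS s d) (N : ℕ) :
    ∃ C : ℝ, 0 ≤ C ∧ ∀ x q, (1 + ‖q - (x, 0)‖) ^ N *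
      ‖gaussianKernel R (schwartzOfSigmaGS hw) (schwartzOfSigmaGS hφ) x q‖ ≤
        C * ((1 + ‖q - (x, 0)‖) ^ (2 * d + 1))⁻¹ := by
  obtain ⟨C, hC, H⟩ := gsBound_gaussianKernel hs hR hw hφ 1 one_pos
  refine ⟨C * ((N + (2 * d + 1)).factorial : ℝ) ^ s, by positivity, fun x q => ?_⟩
  rw [← div_eq_mul_inv, le_div_iff₀ (by positivity)]
  have := H (x, q) (N + (2 * d + 1))
  rw [one_pow, mul_one] at this
  refine (le_of_eq ?_).trans this
  simp only [pow_add]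
  ring

/-- The frequency-shifted point at which the short-time Fourier transform is evaluated. -/
def kernelPoint {d : ℕ} (ξ : Ed d) (q : Ed d × Ed d) : Ed d × Ed d :=
  (q.1, ξ - (2 * Real.pi) • q.2)

theorem continuous_kernelPoint {d : ℕ} (ξ : Ed d) : Continuous (kernelPoint ξ) := by
  unfold kernelPoint
  fun_prop

theorem norm_kernelPoint_sub_le {d : ℕ} (z q : Ed d × Ed d) :
    ‖kernelPoint z.2 q - z‖ ≤ 7 * ‖q - (z.1, 0)‖ := by
  have h1 : ‖q.1 - z.1‖ ≤ ‖q - (z.1, 0)‖ := norm_fst_le (q - (z.1, 0))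
  have h2 : ‖q.2‖ ≤ ‖q - (z.1, 0)‖ := by
    have h := norm_snd_le (q - (z.1, (0 : Ed d)))
    rwa [show (q - (z.1, (0 : Ed d))).2 = q.2 from sub_zero q.2] at h
  have hpi : 2 * Real.pi ≤ 7 := by linarith [Real.pi_lt_d2]
  have h3 : ‖(kernelPoint z.2 q - z).2‖ = 2 * Real.pi * ‖q.2‖ := by
    simp [kernelPoint, norm_smul, abs_of_nonneg Real.pi_nonneg]
  rw [Prod.norm_def, h3]
  refine max_le ?_ ?_
  · exact h1.trans (by linarith [norm_nonneg (q - (z.1, (0 : Ed d)))])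
  · exact mul_le_mul hpi h2 (norm_nonneg _) (by norm_num)

theorem one_add_norm_kernelPoint_le {d : ℕ} (z q : Ed d × Ed d) :
    1 + ‖kernelPoint z.2 q‖ ≤ 7 * (1 + ‖z‖) * (1 + ‖q - (z.1, 0)‖) := by
  have h1 := norm_kernelPoint_sub_le z q
  have h2 : ‖kernelPoint z.2 q‖ ≤ ‖kernelPoint z.2 q - z‖ + ‖z‖ := by
    simpa using norm_add_le (kernelPoint z.2 q - z) z
  nlinarith [norm_nonneg z, norm_nonneg (q - (z.1, (0 : Ed d))),
    mul_nonneg (norm_nonneg z) (norm_nonneg (q - (z.1, (0 : Ed d))))]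

theorem charFn_sub_smul {d : ℕ} (ξ ζ y : Ed d) : charFn (ξ - (2 * Real.pi) • ζ) y =
    charFn ξ y * Complex.exp (↑(2 * Real.pi * ⟪ζ, y⟫) * Complex.I) := by
  rw [charFn, charFn, ← Complex.exp_add]
  congr 1
  rw [inner_sub_right, inner_smul_right, real_inner_comm ζ y]
  push_cast
  ring

open SchwartzMap FourierTransform in
theorem integral_gaussianKernel_mul_charFn {d : ℕ} {R : Matrix (Fin d) (Fin d) ℝ}
    (hR : R.PosSemidef) (w φ : 𝓢(Ed d, ℂ)) (x ξ p y : Ed d) :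
    ∫ ζ, gaussianKernel R w φ x (p, ζ) * charFn (ξ - (2 * Real.pi) • ζ) y =
      charFn ξ y * (gaussianOf R y * ((starRingEnd ℂ) (w (y - x)) * φ (y - p))) := by
  have h : 𝓕⁻ (𝓕 (localizedProduct R w φ x p)) y = localizedProduct R w φ x p y := by
    rw [FourierTransform.fourierInv_fourier_eq]
  rw [fourierInv_coe, Real.fourierInv_eq'] at h
  rw [← localizedProduct_apply hR, ← h, ← integral_const_mul]
  refine integral_congr_ae (Eventually.of_forall fun ζ => ?_)
  simp only [charFn_sub_smul, gaussianKernel, smul_eq_mul]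
  ring

open SchwartzMap in
theorem integrable_gaussianKernel_mul {d : ℕ} {s : ℝ} (hs : 1 / 2 < s)
    {R : Matrix (Fin d) (Fin d) ℝ} (hR : R.PosSemidef) {w φ : Ed d → ℂ} (hw : w ∈ SigmaGS s d)
    (hφ : φ ∈ SigmaGS s d) (z : Ed d × Ed d) {B : ℝ} {N : ℕ} {f : Ed d × Ed d → ℂ}
    (hf : Continuous f) (hfB : ∀ q, ‖f q‖ ≤ B * (1 + ‖q‖) ^ N) :
    Integrable fun q => gaussianKernel R (schwartzOfSigmaGS hw) (schwartzOfSigmaGS hφ) z.1 q *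
      f (kernelPoint z.2 q) := by
  obtain ⟨C, hC, H⟩ := exists_gaussianKernel_le hs hR hw hφ N
  have hB : 0 ≤ B := by
    have := (norm_nonneg _).trans (hfB 0)
    simpa using this
  refine Integrable.mono' ((integrable_one_add_norm_sub_inv_pow z.1).const_mul
    (B * (7 * (1 + ‖z‖)) ^ N * C)) ((continuous_gaussianKernel hR _ _ _).mul
      (hf.comp (continuous_kernelPoint _))).aestronglyMeasurable (Eventually.of_forall fun q => ?_)
  set K := gaussianKernel R (schwartzOfSigmaGS hw) (schwartzOfSigmaGS hφ) z.1 q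
  rw [norm_mul]
  calc ‖K‖ * ‖f (kernelPoint z.2 q)‖ ≤ ‖K‖ * (B * (1 + ‖kernelPoint z.2 q‖) ^ N) := by
        gcongr; exact hfB _
    _ ≤ ‖K‖ * (B * (7 * (1 + ‖z‖) * (1 + ‖q - (z.1, 0)‖)) ^ N) := by
        gcongr; exact one_add_norm_kernelPoint_le z q
    _ = B * (7 * (1 + ‖z‖)) ^ N * ((1 + ‖q - (z.1, 0)‖) ^ N * ‖K‖) := by
        rw [mul_pow]; ring
    _ ≤ B * (7 * (1 + ‖z‖)) ^ N * (C * ((1 + ‖q - (z.1, 0)‖) ^ (2 * d + 1))⁻¹) := by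
        exact mul_le_mul_of_nonneg_left (H z.1 q) (by positivity)
    _ = _ := by ring

open SchwartzMap in
theorem integral_gaussianKernel_mul_atom {d : ℕ} {s : ℝ} (hs : 1 / 2 < s)
    {R : Matrix (Fin d) (Fin d) ℝ} (hR : R.PosSemidef) {w φ : Ed d → ℂ} (hw : w ∈ SigmaGS s d)
    (hφ : φ ∈ SigmaGS s d) (z : Ed d × Ed d) (y : Ed d) :
    ∫ q, gaussianKernel R (schwartzOfSigmaGS hw) (schwartzOfSigmaGS hφ) z.1 q *
      atom (schwartzOfSigmaGS hφ) (kernelPoint z.2 q) y =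
    ((∫ p, ‖φ p‖ ^ 2 : ℝ) : ℂ) * (gaussianOf R y * atom (schwartzOfSigmaGS hw) z y) := by
  have hcont : Continuous fun q => atom (schwartzOfSigmaGS hφ) q y :=
    (contDiff_atomFn (schwartzOfSigmaGS hφ)).continuous.comp (continuous_id.prodMk continuous_const)
  have hint := integrable_gaussianKernel_mul hs hR hw hφ z (B := SchwartzMap.seminorm ℂ 0 0
    (schwartzOfSigmaGS hφ)) (N := 0) hcont fun q => by
      rw [atom_apply, norm_mul, norm_charFn, RCLike.norm_conj]
      simpa using (schwartzOfSigmaGS hφ).norm_le_seminorm ℂ (y - q.1)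
  rw [Measure.volume_eq_prod, integral_prod _ hint]
  have h1 : ∀ p : Ed d, ∫ ζ, gaussianKernel R (schwartzOfSigmaGS hw) (schwartzOfSigmaGS hφ) z.1
      (p, ζ) * atom (schwartzOfSigmaGS hφ) (kernelPoint z.2 (p, ζ)) y =
      (gaussianOf R y * atom (schwartzOfSigmaGS hw) z y) * ((‖φ (y - p)‖ ^ 2 : ℝ) : ℂ) := by
    intro p
    have h2 := integral_gaussianKernel_mul_charFn hR (schwartzOfSigmaGS hw)
      (schwartzOfSigmaGS hφ) z.1 z.2 p y
    calc _ = ∫ ζ, (starRingEnd ℂ) (φ (y - p)) *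
          (gaussianKernel R (schwartzOfSigmaGS hw) (schwartzOfSigmaGS hφ) z.1 (p, ζ) *
            charFn (z.2 - (2 * Real.pi) • ζ) y) := by
          refine integral_congr_ae (Eventually.of_forall fun ζ => ?_)
          simp only [atom_apply, kernelPoint, schwartzOfSigmaGS_apply]
          ring
      _ = _ := by
          rw [integral_const_mul, h2, atom_apply, Complex.ofReal_pow, ← Complex.conj_mul']
          simp only [schwartzOfSigmaGS_apply]
          ring
  simp only [h1]
  rw [integral_const_mul, integral_complex_ofReal,
    integral_sub_left_eq_self (fun p => ‖φ p‖ ^ 2) volume y, mul_comm]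

open SchwartzMap in
theorem integral_gaussianKernel_mul_apply_atom {d : ℕ} {s : ℝ} (hs : 1 / 2 < s)
    {R : Matrix (Fin d) (Fin d) ℝ} (hR : R.PosSemidef) {w φ : Ed d → ℂ} (hw : w ∈ SigmaGS s d)
    (hφ : φ ∈ SigmaGS s d) (u : TD d) (z : Ed d × Ed d) :
    ((∫ p, ‖φ p‖ ^ 2 : ℝ) : ℂ) *
      u (smulLeftCLM ℂ (gaussianOf R) (atom (schwartzOfSigmaGS hw) z)) =
    ∫ q, gaussianKernel R (schwartzOfSigmaGS hw) (schwartzOfSigmaGS hφ) z.1 q *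
      u (atom (schwartzOfSigmaGS hφ) (kernelPoint z.2 q)) := by
  set K := gaussianKernel R (schwartzOfSigmaGS hw) (schwartzOfSigmaGS hφ) z.1 with hK
  have hKc : Continuous K := continuous_gaussianKernel hR _ _ _
  have hac : Continuous fun q => atom (schwartzOfSigmaGS hφ) (kernelPoint z.2 q) :=
    (continuous_atom _).comp (continuous_kernelPoint z.2)
  have h := apply_eq_integral_of_pointwise volume u
    (fun q => K q • atom (schwartzOfSigmaGS hφ) (kernelPoint z.2 q)) (hKc.smul hac)
    (fun k l => ?_)
    (((∫ p, ‖φ p‖ ^ 2 : ℝ) : ℂ) • smulLeftCLM ℂ (gaussianOf R) (atom (schwartzOfSigmaGS hw) z))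
    (fun y => ?_)
  · simpa using h
  · obtain ⟨C, hC, H⟩ := exists_seminorm_atom_le (schwartzOfSigmaGS hφ) k l
    have hsc : Continuous fun q => ((SchwartzMap.seminorm ℂ k l
        (atom (schwartzOfSigmaGS hφ) q) : ℝ) : ℂ) :=
      Complex.continuous_ofReal.comp (((schwartz_withSeminorms ℂ (Ed d) ℂ).continuous_seminorm
        (k, l)).comp (continuous_atom _))
    have := (integrable_gaussianKernel_mul hs hR hw hφ z (B := C) (N := k + l) hsc fun q => by
      rw [Complex.norm_real, Real.norm_of_nonneg (apply_nonneg _ _)]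
      exact H q).norm
    refine this.congr (Eventually.of_forall fun q => ?_)
    simp only [norm_mul, map_smul_eq_mul, Complex.norm_real]
    rw [Real.norm_of_nonneg (apply_nonneg _ _)]
  · simp only [smul_apply, smul_eq_mul]
    rw [integral_gaussianKernel_mul_atom hs hR hw hφ z y,
      smulLeftCLM_apply_apply (hasTemperateGrowth_gaussianOf hR), smul_eq_mul]

theorem rpow_inv_pow_rpow {s r : ℝ} (hs : 0 < s) (hr : 0 ≤ r) (n : ℕ) :
    ((r ^ (1 / s)) ^ n) ^ s = r ^ n := by
  rw [← Real.rpow_natCast, ← Real.rpow_mul hr, ← Real.rpow_mul hr, ← Real.rpow_natCast]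
  congr 1
  field_simp

/-- Exponential decay of every order implies factorially controlled polynomial decay. -/
theorem gsBound_of_exp_decay {ι : Type*} {s : ℝ} (hs : 0 < s) {r t : ι → ℝ} (hr : ∀ i, 0 ≤ r i)
    (ht : ∀ i, 0 ≤ t i)
    (H : ∀ A : ℝ, 0 < A → ∃ C : ℝ, ∀ i, Real.exp (A * r i ^ (1 / s)) * t i ≤ C) :
    GSBound s fun i n => r i ^ n * t i := by
  intro h hh
  obtain ⟨C, hC⟩ := H (s * (1 / h) ^ (1 / s)) (by positivity)
  refine ⟨max C 0, le_max_right _ _, fun i n => ?_⟩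
  have hrh : 0 ≤ r i / h := div_nonneg (hr i) hh.le
  set a := (r i / h) ^ (1 / s) with ha
  have ha0 : 0 ≤ a := by positivity
  have h1 : (a ^ n / n.factorial) ^ s ≤ Real.exp (s * (1 / h) ^ (1 / s) * r i ^ (1 / s)) := by
    calc (a ^ n / n.factorial) ^ s ≤ (Real.exp a) ^ s :=
          Real.rpow_le_rpow (by positivity) (Real.pow_div_factorial_le_exp a ha0 n) hs.le
      _ = _ := by
          rw [← Real.exp_mul, ha, div_eq_mul_one_div, Real.mul_rpow (hr i) (by positivity)]
          congr 1
          ring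
  rw [Real.div_rpow (by positivity) (by positivity), ha, rpow_inv_pow_rpow hs hrh, div_pow,
    div_div, div_le_iff₀ (by positivity)] at h1
  calc r i ^ n * t i ≤ Real.exp (s * (1 / h) ^ (1 / s) * r i ^ (1 / s)) *
        (h ^ n * (n.factorial : ℝ) ^ s) * t i := mul_le_mul_of_nonneg_right h1 (ht i)
    _ = Real.exp (s * (1 / h) ^ (1 / s) * r i ^ (1 / s)) * t i *
        (h ^ n * (n.factorial : ℝ) ^ s) := by ring
    _ ≤ max C 0 * (h ^ n * (n.factorial : ℝ) ^ s) := by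
        gcongr
        exact (hC i).trans (le_max_left _ _)
    _ = _ := by ring

theorem exp_le_two_mul_of_pow_div_factorial_le {x M : ℝ}
    (H : ∀ n : ℕ, (2 * x) ^ n / n.factorial ≤ M) : Real.exp x ≤ 2 * M := by
  have h1 : HasSum (fun n : ℕ => x ^ n / n.factorial) (Real.exp x) := by
    rw [Real.exp_eq_exp_ℝ]
    exact NormedSpace.expSeries_div_hasSum_exp x
  have h2 : HasSum (fun n : ℕ => M * (1 / 2 : ℝ) ^ n) (M * 2) := hasSum_geometric_two.mul_left M
  rw [mul_comm]
  refine hasSum_le (fun n => ?_) h1 h2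
  have h3 := H n
  rw [mul_pow] at h3
  rw [one_div_pow, mul_one_div, le_div_iff₀ (by positivity)]
  calc x ^ n / n.factorial * 2 ^ n = 2 ^ n * x ^ n / n.factorial := by ring
    _ ≤ M := h3

/-- Factorially controlled polynomial decay implies exponential decay of every order. -/
theorem GSBound.exp_decay {ι : Type*} {s : ℝ} (hs : 0 < s) {r t : ι → ℝ} (hr : ∀ i, 0 ≤ r i)
    (ht : ∀ i, 0 ≤ t i) (H : GSBound s fun i n => r i ^ n * t i) {A : ℝ} (hA : 0 < A) :
    ∃ C : ℝ, ∀ i, Real.exp (A * r i ^ (1 / s)) * t i ≤ C := by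
  obtain ⟨C, hC, hCn⟩ := H (((2 * (A / s)) ^ s)⁻¹) (by positivity)
  refine ⟨2 ^ s * C, fun i => ?_⟩
  rcases (ht i).eq_or_lt with h0 | h0
  · rw [← h0, mul_zero]
    positivity
  have h1 : Real.exp (A / s * r i ^ (1 / s)) ≤ 2 * (C / t i) ^ (1 / s) := by
    have := hr i
    refine exp_le_two_mul_of_pow_div_factorial_le fun n => ?_
    have h2 := hCn i n
    have h3 : ((2 * (A / s * r i ^ (1 / s))) ^ n / n.factorial) ^ s ≤ C / t i := by
      rw [le_div_iff₀ h0, Real.div_rpow (by positivity) (by positivity), ← mul_assoc, mul_pow,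
        Real.mul_rpow (by positivity) (by positivity), rpow_inv_pow_rpow hs (hr i)]
      have h4 : ((2 * (A / s)) ^ n) ^ s = ((2 * (A / s)) ^ s) ^ n := by
        rw [← Real.rpow_natCast, ← Real.rpow_natCast, ← Real.rpow_mul (by positivity),
          ← Real.rpow_mul (by positivity), mul_comm (n : ℝ) s]
      rw [h4]
      simp only [inv_pow] at h2
      have h5 : 0 < ((2 * (A / s)) ^ s) ^ n := by positivity
      have h6 : 0 < (n.factorial : ℝ) ^ s := by positivity
      rw [div_mul_eq_mul_div, div_le_iff₀ h6]
      calc ((2 * (A / s)) ^ s) ^ n * r i ^ n * t i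
          = ((2 * (A / s)) ^ s) ^ n * (r i ^ n * t i) := by ring
        _ ≤ ((2 * (A / s)) ^ s) ^ n *
            (C * (((2 * (A / s)) ^ s) ^ n)⁻¹ * (n.factorial : ℝ) ^ s) := by gcongr
        _ = _ := by field_simp
    calc (2 * (A / s * r i ^ (1 / s))) ^ n / n.factorial
        = (((2 * (A / s * r i ^ (1 / s))) ^ n / n.factorial) ^ s) ^ (1 / s) := by
          rw [← Real.rpow_mul (by positivity), mul_one_div_cancel hs.ne', Real.rpow_one]
      _ ≤ _ := Real.rpow_le_rpow (by positivity) h3 (by positivity)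
  have h7 : Real.exp (A * r i ^ (1 / s)) ≤ 2 ^ s * (C / t i) := by
    calc Real.exp (A * r i ^ (1 / s)) = Real.exp (A / s * r i ^ (1 / s)) ^ s := by
          rw [← Real.exp_mul]
          congr 1
          field_simp
      _ ≤ (2 * (C / t i) ^ (1 / s)) ^ s :=
          Real.rpow_le_rpow (Real.exp_pos _).le h1 hs.le
      _ = 2 ^ s * (C / t i) := by
          rw [Real.mul_rpow (by positivity) (by positivity),
            ← Real.rpow_mul (by positivity), one_div_mul_cancel hs.ne', Real.rpow_one]
  calc Real.exp (A * r i ^ (1 / s)) * t i ≤ 2 ^ s * (C / t i) * t i := by gcongr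
    _ = 2 ^ s * C := by field_simp

/-- Points of a smaller conic neighbourhood are far from the complement of a conic set. -/
theorem exists_conic_nhds_separated {V : Type*} [NormedAddCommGroup V] [NormedSpace ℝ V]
    {Γ : Set V} (hΓ : IsOpen Γ) (hconic : IsConic Γ) (h0 : (0 : V) ∉ Γ) {z₀ : V} (hz₀ : z₀ ∈ Γ) :
    ∃ Γ' : Set V, IsOpen Γ' ∧ IsConic Γ' ∧ (0 : V) ∉ Γ' ∧ z₀ ∈ Γ' ∧
      ∃ L : ℝ, 0 ≤ L ∧ ∀ z ∈ Γ', ∀ z' ∉ Γ, ‖z‖ ≤ L * ‖z' - z‖ := by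
  obtain ⟨δ, hδ, hball⟩ := Metric.isOpen_iff.1 hΓ z₀ hz₀
  refine ⟨{z | ∃ t : ℝ, 0 < t ∧ t • z ∈ Metric.ball z₀ (δ / 2)}, ?_, ?_, ?_, ?_,
    (‖z₀‖ + δ / 2) / (δ / 2), by positivity, ?_⟩
  · have : {z : V | ∃ t : ℝ, 0 < t ∧ t • z ∈ Metric.ball z₀ (δ / 2)} =
        ⋃ t : {t : ℝ // 0 < t}, (fun z => (t : ℝ) • z) ⁻¹' Metric.ball z₀ (δ / 2) := by
      ext z
      simp
    rw [this]
    exact isOpen_iUnion fun t => Metric.isOpen_ball.preimage (continuous_const_smul _)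
  · rintro c hc z ⟨t, ht, htz⟩
    refine ⟨t / c, by positivity, ?_⟩
    rwa [smul_smul, div_mul_cancel₀ _ hc.ne']
  · rintro ⟨t, -, ht⟩
    rw [smul_zero] at ht
    exact h0 (hball (Metric.ball_subset_ball (by linarith) ht))
  · exact ⟨1, one_pos, by simpa using half_pos hδ⟩
  · rintro z ⟨t, ht, htz⟩ z' hz'
    have h1 : t • z' ∉ Metric.ball z₀ δ := fun h => hz' (by
      have := hconic t⁻¹ (by positivity) _ (hball h)
      rwa [smul_smul, inv_mul_cancel₀ ht.ne', one_smul] at this)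
    rw [Metric.mem_ball, dist_eq_norm, not_lt] at h1
    rw [Metric.mem_ball, dist_eq_norm] at htz
    have h2 : δ / 2 ≤ t * ‖z' - z‖ := by
      have h3 : ‖t • z' - z₀‖ ≤ ‖t • (z' - z)‖ + ‖t • z - z₀‖ := by
        calc ‖t • z' - z₀‖ = ‖t • (z' - z) + (t • z - z₀)‖ := by congr 1; rw [smul_sub]; abel
          _ ≤ _ := norm_add_le _ _
      rw [norm_smul, Real.norm_of_nonneg ht.le] at h3
      linarith
    have h4 : t * ‖z‖ ≤ ‖z₀‖ + δ / 2 := by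
      have h5 : ‖t • z‖ ≤ ‖z₀‖ + ‖t • z - z₀‖ := by simpa using norm_add_le z₀ (t • z - z₀)
      rw [norm_smul, Real.norm_of_nonneg ht.le] at h5
      linarith
    refine le_of_mul_le_mul_left ?_ ht
    calc t * ‖z‖ ≤ (‖z₀‖ + δ / 2) / (δ / 2) * (δ / 2) := by
          rwa [div_mul_cancel₀ _ (by positivity)]
      _ ≤ (‖z₀‖ + δ / 2) / (δ / 2) * (t * ‖z' - z‖) := by gcongr
      _ = _ := by ring

/-- Microlocal bookkeeping: the kernel `K` decays rapidly in `ρ`, the amplitude `W` decays rapidly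
in `Z'` where `P` holds and grows polynomially elsewhere, and `Z` is comparable with `Z'` up to
`ρ`. -/
theorem GSBound.mul_of_separated {ι : Type*} {s : ℝ} (hs : 0 < s) {Z Z' ρ K W : ι → ℝ}
    {P : ι → Prop} (hZ : ∀ i, 0 ≤ Z i) (hZ' : ∀ i, 0 ≤ Z' i) (hρ : ∀ i, 0 ≤ ρ i)
    (hK0 : ∀ i, 0 ≤ K i) (hW0 : ∀ i, 0 ≤ W i)
    (hK : GSBound s fun i n => (1 + ρ i) ^ n * K i)
    (hW : GSBound s fun (i : {i // P i}) n => Z' i ^ n * W i)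
    {C₀ L : ℝ} {N : ℕ} (hC₀ : 0 ≤ C₀) (hL : 0 ≤ L) (hWN : ∀ i, W i ≤ C₀ * (1 + Z' i) ^ N)
    (h1 : ∀ i, Z i ≤ Z' i + 7 * ρ i) (h2 : ∀ i, Z' i ≤ Z i + 7 * ρ i)
    (h3 : ∀ i, ¬ P i → Z i ≤ L * ρ i) (M : ℕ) :
    GSBound s fun i n => (1 + ρ i) ^ M * (Z i ^ n * (K i * W i)) := by
  obtain ⟨A, hA, hAW⟩ := hW 1 one_pos
  obtain ⟨B, hB, hBK⟩ := (hK.shift hs.le M) 1 one_pos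
  have hB' : ∀ i, (1 + ρ i) ^ M * K i ≤ B := fun i => by simpa using hBK i 0
  have hA' : ∀ i, P i → W i ≤ A := fun i hi => by simpa using hAW ⟨i, hi⟩ 0
  have hin : GSBound s fun (i : {i // P i}) n =>
      (1 + ρ i) ^ M * (Z i ^ n * (K i * W i)) := by
    refine ((hW.pow_mul hB zero_le_two).add (((hK.shift hs.le M).reindex
      (fun i : {i // P i} => (i : ι))).pow_mul hA (by norm_num : (0 : ℝ) ≤ 14))).mono ?_
    rintro ⟨i, hi⟩ n
    simp only
    have := hZ i; have := hZ' i; have := hρ i; have := hK0 i; have := hW0 i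
    have h4 : Z i ^ n ≤ 2 ^ n * Z' i ^ n + 14 ^ n * (1 + ρ i) ^ n := by
      rcases le_total (Z' i) (7 * (1 + ρ i)) with h | h
      · calc Z i ^ n ≤ (14 * (1 + ρ i)) ^ n :=
              pow_le_pow_left₀ (hZ i) (by linarith [h1 i]) n
          _ ≤ _ := by rw [mul_pow]; linarith [show 0 ≤ 2 ^ n * Z' i ^ n by positivity]
      · calc Z i ^ n ≤ (2 * Z' i) ^ n := pow_le_pow_left₀ (hZ i) (by linarith [h1 i]) n
          _ ≤ _ := by
            rw [mul_pow]
            linarith [show (0 : ℝ) ≤ 14 ^ n * (1 + ρ i) ^ n by positivity]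
    calc (1 + ρ i) ^ M * (Z i ^ n * (K i * W i))
        ≤ (1 + ρ i) ^ M * ((2 ^ n * Z' i ^ n + 14 ^ n * (1 + ρ i) ^ n) * (K i * W i)) := by gcongr
      _ = ((1 + ρ i) ^ M * K i) * (2 ^ n * (Z' i ^ n * W i)) +
          14 ^ n * ((1 + ρ i) ^ (n + M) * K i) * W i := by rw [pow_add]; ring
      _ ≤ B * (2 ^ n * (Z' i ^ n * W i)) + 14 ^ n * ((1 + ρ i) ^ (n + M) * K i) * A :=
          add_le_add (mul_le_mul_of_nonneg_right (hB' i) (by positivity))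
            (mul_le_mul_of_nonneg_left (hA' i hi) (by positivity))
      _ = _ := by ring
  have hout : GSBound s fun (i : {i // ¬ P i}) n =>
      (1 + ρ i) ^ M * (Z i ^ n * (K i * W i)) := by
    refine (((hK.shift hs.le (N + M)).reindex (fun i : {i // ¬ P i} => (i : ι))).pow_mul
      (B := C₀ * (L + 7) ^ N) (by positivity) hL).mono ?_
    rintro ⟨i, hi⟩ n
    simp only
    have := hZ i; have := hZ' i; have := hρ i; have := hK0 i; have := hW0 i
    have h4 : Z i ≤ L * (1 + ρ i) := by nlinarith [h3 i hi]
    have h5 : 1 + Z' i ≤ (L + 7) * (1 + ρ i) := by nlinarith [h3 i hi, h2 i]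
    calc (1 + ρ i) ^ M * (Z i ^ n * (K i * W i))
        ≤ (1 + ρ i) ^ M * ((L * (1 + ρ i)) ^ n *
            (K i * (C₀ * ((L + 7) * (1 + ρ i)) ^ N))) := by
          gcongr
          exact (hWN i).trans (by gcongr)
      _ = _ := by rw [pow_add, pow_add, mul_pow, mul_pow]; ring
  intro h hh
  obtain ⟨C, hC, HC⟩ := hin h hh
  obtain ⟨D, hD, HD⟩ := hout h hh
  refine ⟨max C D, hC.trans (le_max_left _ _), fun i n => ?_⟩
  by_cases hi : P i
  · exact (HC ⟨i, hi⟩ n).trans (by gcongr; exact le_max_left _ _)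
  · exact (HD ⟨i, hi⟩ n).trans (by gcongr; exact le_max_right _ _)

theorem pnorm_nonneg {d : ℕ} (z : Ed d × Ed d) : 0 ≤ pnorm z := Real.sqrt_nonneg _

theorem norm_le_pnorm {d : ℕ} (z : Ed d × Ed d) : ‖z‖ ≤ pnorm z := by
  refine max_le ?_ ?_ <;> refine Real.le_sqrt_of_sq_le ?_
  · linarith [sq_nonneg ‖z.2‖]
  · linarith [sq_nonneg ‖z.1‖]

theorem pnorm_le_two_mul_norm {d : ℕ} (z : Ed d × Ed d) : pnorm z ≤ 2 * ‖z‖ := by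
  refine Real.sqrt_le_iff.2 ⟨by positivity, ?_⟩
  have h1 := pow_le_pow_left₀ (norm_nonneg _) (norm_fst_le z) 2
  have h2 := pow_le_pow_left₀ (norm_nonneg _) (norm_snd_le z) 2
  nlinarith [sq_nonneg ‖z‖]

theorem gsBound_iff_forall_exp_pnorm {d : ℕ} {s : ℝ} (hs : 0 < s) (Γ : Set (Ed d × Ed d))
    (W : Ed d × Ed d → ℂ) :
    (GSBound s fun (z : Γ) n => ‖(z : Ed d × Ed d)‖ ^ n * ‖W z‖) ↔
      ∀ A : ℝ, 0 < A → ∃ C : ℝ, ∀ z ∈ Γ, Real.exp (A * pnorm z ^ (1 / s)) * ‖W z‖ ≤ C := by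
  constructor
  · intro H A hA
    have H' : GSBound s fun (z : Γ) n => pnorm (z : Ed d × Ed d) ^ n * ‖W z‖ := by
      refine (H.pow_mul zero_le_one zero_le_two).mono fun z n => ?_
      calc pnorm (z : Ed d × Ed d) ^ n * ‖W z‖ ≤ (2 * ‖(z : Ed d × Ed d)‖) ^ n * ‖W z‖ := by
            gcongr
            · exact pnorm_nonneg _
            · exact pnorm_le_two_mul_norm _
        _ = _ := by ring
    obtain ⟨C, hC⟩ := H'.exp_decay hs (fun z => pnorm_nonneg _) (fun z => norm_nonneg _) hA
    exact ⟨C, fun z hz => hC ⟨z, hz⟩⟩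
  · intro H
    have H' : GSBound s fun (z : Γ) n => pnorm (z : Ed d × Ed d) ^ n * ‖W z‖ := by
      refine gsBound_of_exp_decay hs (fun z => pnorm_nonneg _) (fun z => norm_nonneg _)
        fun A hA => ?_
      obtain ⟨C, hC⟩ := H A hA
      exact ⟨C, fun z => hC z z.2⟩
    refine H'.mono fun z n => ?_
    gcongr
    exact norm_le_pnorm _

theorem IsSTFT.eq_apply_atom {d : ℕ} {u : TD d} {φ : Ed d → ℂ} {s : ℝ} (hφ : φ ∈ SigmaGS s d)
    {W : Ed d × Ed d → ℂ} (hW : IsSTFT u φ W) (z : Ed d × Ed d) :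
    W z = u (atom (schwartzOfSigmaGS hφ) z) :=
  hW z.1 z.2 _ fun y => by rw [atom_apply, schwartzOfSigmaGS_apply, charFn]

theorem integral_norm_sq_pos {d : ℕ} {s : ℝ} {φ : Ed d → ℂ} (hφ : φ ∈ SigmaGS s d) (hφ0 : φ ≠ 0) :
    0 < ∫ p, ‖φ p‖ ^ 2 := by
  have hint : Integrable fun p => ‖φ p‖ ^ 2 := by
    have h := (schwartzOfSigmaGS hφ).memLp 2 volume
    simpa using h.integrable_norm_pow (by norm_num)
  rw [integral_pos_iff_support_of_nonneg (fun p => by positivity) hint]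
  have hc : Continuous fun p => ‖φ p‖ ^ 2 := (hφ.1.continuous.norm).pow 2
  refine hc.isOpen_support.measure_pos volume ?_
  obtain ⟨p, hp⟩ := Function.ne_iff.1 hφ0
  exact ⟨p, by simpa using hp⟩

theorem integral_one_add_norm_sub_inv_pow {d : ℕ} (x : Ed d) :
    ∫ q : Ed d × Ed d, ((1 + ‖q - (x, 0)‖) ^ (2 * d + 1))⁻¹ =
      ∫ q : Ed d × Ed d, ((1 + ‖q‖) ^ (2 * d + 1))⁻¹ := by
  have := isAddHaarMeasure_volume_prod d
  exact integral_sub_right_eq_self (fun q : Ed d × Ed d => ((1 + ‖q‖) ^ (2 * d + 1))⁻¹) (x, 0)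

theorem gsBound_of_integral_kernel {d : ℕ} {s : ℝ} (hs : 1 / 2 < s)
    {R : Matrix (Fin d) (Fin d) ℝ} (hR : R.PosSemidef) {w φ : Ed d → ℂ} (hw : w ∈ SigmaGS s d)
    (hφ : φ ∈ SigmaGS s d) (u : TD d) {Γ Γ' : Set (Ed d × Ed d)} {L : ℝ} (hL : 0 ≤ L)
    (hsep : ∀ z ∈ Γ', ∀ z' ∉ Γ, ‖z‖ ≤ L * ‖z' - z‖)
    (hΓ : GSBound s fun (z : Γ) n =>
      ‖(z : Ed d × Ed d)‖ ^ n * ‖u (atom (schwartzOfSigmaGS hφ) z)‖) :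
    GSBound s fun (z : Γ') n => ‖(z : Ed d × Ed d)‖ ^ n *
      ‖∫ q, gaussianKernel R (schwartzOfSigmaGS hw) (schwartzOfSigmaGS hφ) (z : Ed d × Ed d).1 q *
        u (atom (schwartzOfSigmaGS hφ) (kernelPoint (z : Ed d × Ed d).2 q))‖ := by
  have hs0 : 0 < s := by linarith
  obtain ⟨C₀, N, hC₀, hN⟩ := exists_norm_apply_atom_le u (schwartzOfSigmaGS hφ)
  set K := gaussianKernel R (schwartzOfSigmaGS hw) (schwartzOfSigmaGS hφ) with hK
  set W := fun z => u (atom (schwartzOfSigmaGS hφ) z) with hW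
  have hkey := GSBound.mul_of_separated (ι := Γ' × (Ed d × Ed d)) hs0
    (Z := fun i => ‖(i.1 : Ed d × Ed d)‖)
    (Z' := fun i => ‖kernelPoint (i.1 : Ed d × Ed d).2 i.2‖)
    (ρ := fun i => ‖i.2 - ((i.1 : Ed d × Ed d).1, 0)‖)
    (K := fun i => ‖K (i.1 : Ed d × Ed d).1 i.2‖)
    (W := fun i => ‖W (kernelPoint (i.1 : Ed d × Ed d).2 i.2)‖)
    (P := fun i => kernelPoint (i.1 : Ed d × Ed d).2 i.2 ∈ Γ)
    (fun _ => norm_nonneg _) (fun _ => norm_nonneg _) (fun _ => norm_nonneg _)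
    (fun _ => norm_nonneg _) (fun _ => norm_nonneg _)
    ((gsBound_gaussianKernel hs hR hw hφ).reindex
      fun i : Γ' × (Ed d × Ed d) => ((i.1 : Ed d × Ed d).1, i.2))
    (hΓ.reindex fun i : {i : Γ' × (Ed d × Ed d) // kernelPoint (i.1 : Ed d × Ed d).2 i.2 ∈ Γ} =>
      (⟨kernelPoint (i.1.1 : Ed d × Ed d).2 i.1.2, i.2⟩ : Γ))
    hC₀ (L := L * 7) (by positivity) (fun i => hN _) (fun i => ?_) (fun i => ?_) (fun i hi => ?_)
    (2 * d + 1)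
  · intro h hh
    obtain ⟨C, hC, HC⟩ := hkey h hh
    refine ⟨C * ∫ q : Ed d × Ed d, ((1 + ‖q‖) ^ (2 * d + 1))⁻¹,
      mul_nonneg hC (integral_nonneg fun q => by positivity), fun z n => ?_⟩
    obtain ⟨z, hz⟩ := z
    simp only
    calc ‖z‖ ^ n * ‖∫ q, K z.1 q * W (kernelPoint z.2 q)‖
        ≤ ‖z‖ ^ n * ∫ q, ‖K z.1 q‖ * ‖W (kernelPoint z.2 q)‖ := by
          gcongr
          refine (norm_integral_le_integral_norm _).trans (le_of_eq ?_)
          simp only [norm_mul]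
      _ = ∫ q, ‖z‖ ^ n * (‖K z.1 q‖ * ‖W (kernelPoint z.2 q)‖) := by rw [integral_const_mul]
      _ ≤ ∫ q : Ed d × Ed d,
          C * h ^ n * (n.factorial : ℝ) ^ s * ((1 + ‖q - (z.1, 0)‖) ^ (2 * d + 1))⁻¹ := by
          refine integral_mono_of_nonneg (Eventually.of_forall fun q => by positivity)
            ((integrable_one_add_norm_sub_inv_pow z.1).const_mul _)
            (Eventually.of_forall fun q => ?_)
          simp only
          rw [← div_eq_mul_inv, le_div_iff₀ (by positivity), mul_comm]
          exact HC (⟨z, hz⟩, q) n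
      _ = _ := by
          rw [integral_const_mul, integral_one_add_norm_sub_inv_pow]
          ring
  · have h1 := norm_kernelPoint_sub_le (i.1 : Ed d × Ed d) i.2
    rw [norm_sub_rev] at h1
    have h2 := norm_sub_norm_le (i.1 : Ed d × Ed d) (kernelPoint (i.1 : Ed d × Ed d).2 i.2)
    linarith
  · have h1 := norm_kernelPoint_sub_le (i.1 : Ed d × Ed d) i.2
    have h2 := norm_sub_norm_le (kernelPoint (i.1 : Ed d × Ed d).2 i.2) (i.1 : Ed d × Ed d)
    linarith
  · refine (hsep _ i.1.2 _ hi).trans ?_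
    rw [mul_assoc]
    exact mul_le_mul_of_nonneg_left (norm_kernelPoint_sub_le _ _) hL

theorem statement19 (d : ℕ) (s : ℝ) (hs : 1/2 < s)
    (R : Matrix (Fin d) (Fin d) ℝ) (hR : R.IsSymm) (hR' : R.PosSemidef)
    (u v : TD d)
    (hv : ∀ ψ ψ' : SchwartzMap (Ed d) ℂ,
      (∀ y : Ed d, ψ' y = ((Real.exp (-(qf R y)) : ℝ) : ℂ) * ψ y) → v ψ = u ψ')
    (φ w : Ed d → ℂ) (hφ : φ ∈ SigmaGS s d) (hφ0 : φ ≠ 0)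
    (hw : w ∈ SigmaGS s d) (hw0 : w ≠ 0)
    (Wu Wv : Ed d × Ed d → ℂ) (hWu : IsSTFT u φ Wu) (hWv : IsSTFT v w Wv) :
    WFs s Wv ⊆ WFs s Wu := by
  rintro z₀ ⟨hz₀, hWF⟩
  refine ⟨hz₀, ?_⟩
  rintro ⟨Γ, hΓ, hconic, h0, hzΓ, hdecay⟩
  have hs0 : 0 < s := by linarith
  obtain ⟨Γ', hΓ', hconic', h0', hzΓ', L, hL, hsep⟩ :=
    exists_conic_nhds_separated hΓ hconic h0 hzΓ
  refine hWF ⟨Γ', hΓ', hconic', h0', hzΓ', (gsBound_iff_forall_exp_pnorm hs0 Γ' Wv).1 ?_⟩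
  have hu := (gsBound_iff_forall_exp_pnorm hs0 Γ Wu).2 hdecay
  simp only [hWu.eq_apply_atom hφ] at hu
  have hc := integral_norm_sq_pos hφ hφ0
  set c := ∫ p, ‖φ p‖ ^ 2
  have hvu : ∀ z, ‖Wv z‖ = c⁻¹ * ‖∫ q, gaussianKernel R (schwartzOfSigmaGS hw)
      (schwartzOfSigmaGS hφ) z.1 q * u (atom (schwartzOfSigmaGS hφ) (kernelPoint z.2 q))‖ := by
    intro z
    rw [← integral_gaussianKernel_mul_apply_atom hs hR' hw hφ u z, norm_mul, Complex.norm_real,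
      Real.norm_of_nonneg hc.le, inv_mul_cancel_left₀ hc.ne', hWv.eq_apply_atom hw,
      hv _ (SchwartzMap.smulLeftCLM ℂ (gaussianOf R) (atom (schwartzOfSigmaGS hw) z)) fun y => ?_]
    rw [SchwartzMap.smulLeftCLM_apply_apply (hasTemperateGrowth_gaussianOf hR'), smul_eq_mul]
    rfl
  refine ((gsBound_of_integral_kernel hs hR' hw hφ u hL hsep hu).const_mul
    (inv_nonneg.2 hc.le)).mono fun z n => ?_
  rw [hvu, mul_left_comm]

end
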